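/- Under the Setup, assume that f has finite order and finitely many poles. Then either f'/f is a rational function, or f(z) = B(1 − T(z)·e^{iAz}), where A is a nonzero real number, B is a nonzero complex number, and T is a rational function satisfying |T(x)| = 1 for all real x. -/

import Mathlib

open Complex Filter Topology MeasureTheory
open scoped Classical

noncomputable section

/-- `mtilde f` is the function `z ↦ conj (f (conj z))`, denoted `f̃` in the paper. -/
def mtilde (f : ℂ → ℂ) : ℂ → ℂ := fun z => (starRingEnd ℂ) (f ((starRingEnd ℂ) z))

/-- Equality of meromorphic functions: near every point of `ℂ`, the two functions agree on a
punctured neighbourhood (so the set where they disagree is closed and discrete). -/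
def MeroEq (h₁ h₂ : ℂ → ℂ) : Prop := ∀ z : ℂ, ∀ᶠ w in 𝓝[≠] z, h₁ w = h₂ w

/-- `f` is strictly non-real: `f̃` is not a constant multiple of `f`. -/
def StrictlyNonReal (f : ℂ → ℂ) : Prop := ¬ ∃ c : ℂ, MeroEq (mtilde f) (fun z => c * f z)

/-- A rational function, as a meromorphic function on `ℂ`. -/
def IsRatFn (h : ℂ → ℂ) : Prop :=
  ∃ p q : Polynomial ℂ, q ≠ 0 ∧ MeroEq h (fun z => p.eval z / q.eval z)

/-- The order of vanishing (negative at a pole) of a function at a point, when the function is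
meromorphic there; junk value `0` otherwise. -/
def meroOrder (h : ℂ → ℂ) (z : ℂ) : WithTop ℤ :=
  if hh : MeromorphicAt h z then meromorphicOrderAt h z else 0

/-- The positive part of the logarithm. -/
def logPlus (x : ℝ) : ℝ := max (Real.log x) 0

/-- The Nevanlinna proximity function `m(r, h)`. -/
def proximity (h : ℂ → ℂ) (r : ℝ) : ℝ :=
  (2 * Real.pi)⁻¹ * ∫ θ in (0:ℝ)..(2 * Real.pi),
    logPlus ‖h ((r : ℂ) * Complex.exp (θ * Complex.I))‖

/-- The multiplicity of a pole of `h` at `z` (0 if not a pole). -/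
def poleMult (h : ℂ → ℂ) (z : ℂ) : ℕ := (-((meroOrder h z).untopD 0)).toNat

/-- The number of poles, counted with multiplicity, in the closed disc of radius `t`. -/
def poleCount (h : ℂ → ℂ) (t : ℝ) : ℝ := ∑ᶠ z ∈ Metric.closedBall (0:ℂ) t, (poleMult h z : ℝ)

/-- The integrated counting function `N(r, h)` of the poles of `h` (with multiplicity). -/
def NCount (h : ℂ → ℂ) (r : ℝ) : ℝ := ∫ t in (1:ℝ)..r, poleCount h t / t

/-- The Nevanlinna characteristic `T(r, h) = m(r, h) + N(r, h)`. -/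
def TChar (h : ℂ → ℂ) (r : ℝ) : ℝ := proximity h r + NCount h r

/-- The number of points of `S` in the closed disc of radius `t`. -/
def distinctCount (S : Set ℂ) (t : ℝ) : ℝ := (S ∩ Metric.closedBall (0:ℂ) t).ncard

/-- The integrated counting function `N̄(r, h)` of the distinct poles of `h`. -/
def NbarPoles (h : ℂ → ℂ) (r : ℝ) : ℝ :=
  ∫ t in (1:ℝ)..r, distinctCount {z | meroOrder h z < 0} t / t

/-- The integrated counting function `N̄(r, 1/h)` of the distinct zeros of `h`. -/
def NbarZeros (h : ℂ → ℂ) (r : ℝ) : ℝ :=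
  ∫ t in (1:ℝ)..r, distinctCount {z | 0 < meroOrder h z} t / t

/-- `h` has finite (Nevanlinna) order: `T(r, h) ≤ r ^ C` for all large `r`. -/
def FiniteOrder (h : ℂ → ℂ) : Prop := ∃ C : ℝ, ∀ᶠ r in atTop, TChar h r ≤ r ^ C

/-- `h` has finite lower order: `T(r, h) ≤ r ^ C` for arbitrarily large `r`. -/
def FiniteLowerOrder (h : ℂ → ℂ) : Prop := ∃ C : ℝ, ∃ᶠ r in atTop, TChar h r ≤ r ^ C

/-- The Setup of Section 3 of the paper: `M ≥ 4` and `f` is a strictly non-real meromorphic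
function in the plane such that `f, f', …, f^(M+3)` all have finitely many non-real zeros. -/
def Setup (M : ℕ) (f : ℂ → ℂ) : Prop :=
  4 ≤ M ∧ (∀ z, MeromorphicAt f z) ∧ StrictlyNonReal f ∧
    ∀ m, m ≤ M + 3 → {z : ℂ | 0 < meroOrder (iteratedDeriv m f) z ∧ z.im ≠ 0}.Finite

/-- The function `F_m(z) = z - f^(m)(z) / f^(m+1)(z)`. -/
def Fm (f : ℂ → ℂ) (m : ℕ) : ℂ → ℂ :=
  fun z => z - iteratedDeriv m f z / iteratedDeriv (m + 1) f z

/-- `Km` is the meromorphic function with finitely many zeros and poles satisfying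
`F_m' = K_m G_m'`, where `G_m` is the analogue of `F_m` for `g = f̃`. -/
def IsKm (f : ℂ → ℂ) (m : ℕ) (Km : ℂ → ℂ) : Prop :=
  (∀ z, MeromorphicAt Km z) ∧ {z | 0 < meroOrder Km z}.Finite ∧
    {z | meroOrder Km z < 0}.Finite ∧
    MeroEq (deriv (Fm f m)) (fun z => Km z * deriv (Fm (mtilde f) m) z)

end

/-- the Poisson kernel centred at zero -/
noncomputable def PK (w : ℂ) : ℂ → ℝ := Complex.re ∘ herglotzRieszKernel 0 w

theorem PK_cont {w : ℂ} {R : ℝ} (hw : w ∈ Metric.ball (0:ℂ) R) :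
    ContinuousOn (PK w) (Metric.sphere (0:ℂ) |R|) := by
  have hR : 0 < R := Metric.pos_of_mem_ball hw
  rw [abs_of_pos hR]
  unfold PK
  rw [herglotzRieszKernel_fun_def]
  apply Complex.continuous_re.comp_continuousOn
  apply ContinuousOn.div (by fun_prop) (by fun_prop)
  intro z hz h
  simp at hz hw
  have : z = w := by linear_combination h
  subst this
  linarith

theorem PK_le {w z : ℂ} {R : ℝ} (hw : w ∈ Metric.ball (0:ℂ) (R/2)) (hz : z ∈ Metric.sphere (0:ℂ) R) :
    PK w z ≤ 3 := by
  have h0 : 0 < R := by have := Metric.pos_of_mem_ball hw; linarith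
  have hw' : w ∈ Metric.ball (0:ℂ) R := Metric.ball_subset_ball (by linarith) hw
  have h := re_herglotzRieszKernel_le hz hw'
  simp only [PK, herglotzRieszKernel_fun_def, Function.comp]
  refine h.trans ?_
  simp at hw ⊢
  rw [div_le_iff₀ (by linarith)]
  linarith

theorem PK_nonneg {w z : ℂ} {R : ℝ} (hw : w ∈ Metric.ball (0:ℂ) R) (hz : z ∈ Metric.sphere (0:ℂ) R) :
    0 ≤ PK w z := by
  have h := le_re_herglotzRieszKernel hz hw
  simp only [PK, herglotzRieszKernel_fun_def, Function.comp]
  refine le_trans ?_ h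
  simp at hw ⊢
  apply div_nonneg <;> linarith [norm_nonneg w]

theorem PK_harm {w : ℂ} {R : ℝ} {g : ℂ → ℂ} (hw : w ∈ Metric.ball (0:ℂ) R)
    (hg : AnalyticOnNhd ℂ g (Metric.closedBall 0 R)) (hg0 : ∀ z ∈ Metric.closedBall (0:ℂ) R, g z ≠ 0) :
    Real.circleAverage (PK w * fun z => Real.log ‖g z‖) 0 R = Real.log ‖g w‖ := by
  have : InnerProductSpace.HarmonicOnNhd (fun z => Real.log ‖g z‖) (Metric.closedBall 0 R) :=
    fun z hz => (hg z hz).harmonicAt_log_norm (hg0 z hz)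
  exact this.circleAverage_re_herglotzRieszKernel_smul hw

theorem PK_lin {w u : ℂ} {R : ℝ} (hw : w ∈ Metric.ball (0:ℂ) R) (hu : u ∈ Metric.closedBall (0:ℂ) R)
    (hwu : w ≠ u) :
    Real.log ‖w - u‖ ≤ Real.circleAverage (PK w * fun z => Real.log ‖z - u‖) 0 R := by
  have hR : 0 < R := Metric.pos_of_mem_ball hw
  simp at hu
  rcases hu.lt_or_eq with h | h
  · have hne : ∀ z ∈ Metric.closedBall (0:ℂ) R, (R:ℂ) ^ 2 - (starRingEnd ℂ) u * z ≠ 0 := by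
      intro z hz h0
      simp at hz
      have h1 : (R:ℂ) ^ 2 = (starRingEnd ℂ) u * z := by linear_combination h0
      have h2 := congrArg norm h1
      simp [abs_of_pos hR] at h2
      have : ‖u‖ * ‖z‖ ≤ ‖u‖ * R := mul_le_mul_of_nonneg_left hz (norm_nonneg _)
      nlinarith
    have hne' : ∀ z ∈ Metric.closedBall (0:ℂ) R, ((R:ℂ) ^ 2 - (starRingEnd ℂ) u * z) / R ≠ 0 :=
      fun z hz => div_ne_zero (hne z hz) (by exact_mod_cast hR.ne')
    have key := PK_harm (g := fun z => ((R:ℂ) ^ 2 - (starRingEnd ℂ) u * z) / R) hw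
      (fun z _ => by fun_prop) hne'
    have hsq : ∀ z : ℂ, ‖(R:ℂ)^2 - (starRingEnd ℂ) u * z‖^2 - R^2 * ‖z - u‖^2
        = (R^2 - ‖u‖^2) * (R^2 - ‖z‖^2) := by
      intro z
      rw [← Complex.normSq_eq_norm_sq, ← Complex.normSq_eq_norm_sq, ← Complex.normSq_eq_norm_sq,
        ← Complex.normSq_eq_norm_sq]
      have e : (R:ℂ)^2 = ((R^2 : ℝ) : ℂ) := by push_cast; rfl
      rw [e]
      simp only [Complex.normSq_apply, Complex.sub_re, Complex.sub_im, Complex.mul_re, Complex.mul_im,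
        Complex.conj_re, Complex.conj_im, Complex.ofReal_re, Complex.ofReal_im]
      ring
    have hs : Set.EqOn (PK w * fun z => Real.log ‖z - u‖)
        (PK w * fun z => Real.log ‖((R:ℂ) ^ 2 - (starRingEnd ℂ) u * z) / R‖) (Metric.sphere 0 |R|) := by
      intro z hz
      rw [abs_of_pos hR] at hz
      simp at hz
      simp only [Pi.mul_apply]
      congr 2
      rw [norm_div]
      have := hsq z
      rw [hz, sub_self, mul_zero] at this
      have h3 : ‖(R:ℂ)^2 - (starRingEnd ℂ) u * z‖ = R * ‖z - u‖ := by
        rw [← sq_eq_sq₀ (norm_nonneg _) (by positivity)]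
        linear_combination this
      rw [h3, Complex.norm_real, Real.norm_of_nonneg hR.le]
      field_simp
    rw [Real.circleAverage_congr_sphere hs, key]
    apply Real.log_le_log (norm_pos_iff.2 (sub_ne_zero.2 hwu))
    rw [norm_div, Complex.norm_real, Real.norm_of_nonneg hR.le, le_div_iff₀ hR]
    have := hsq w
    simp at hw
    have h4 : 0 ≤ (R^2 - ‖u‖^2) * (R^2 - ‖w‖^2) :=
      mul_nonneg (by nlinarith [norm_nonneg u]) (by nlinarith [norm_nonneg w])
    rw [← sq_le_sq₀ (by positivity) (norm_nonneg _)]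
    nlinarith
  · have := circleAverage_re_herglotzRieszKernel_mul_log (w := w) (ρ := u) (c := 0) (R := R) (by simpa using h) hw
    exact this.ge

theorem PK_sub {F : ℂ → ℂ} (hF : Differentiable ℂ F) (hF0 : ∃ z, F z ≠ 0) {R : ℝ} (hR : 0 < R) :
    ∀ w0 ∈ Metric.ball (0:ℂ) R, ∀ᶠ w in 𝓝[≠] w0,
      Real.log ‖F w‖ ≤ Real.circleAverage (PK w * fun z => Real.log ‖F z‖) 0 R := by
  have hFa : AnalyticOnNhd ℂ F Set.univ := fun z _ => hF.analyticAt z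
  have hord : ∀ u, meromorphicOrderAt F u ≠ ⊤ := by
    intro u hu
    rw [meromorphicOrderAt_eq_top_iff] at hu
    obtain ⟨z, hz⟩ := hF0
    have := hFa.eqOn_zero_of_preconnected_of_frequently_eq_zero isPreconnected_univ (Set.mem_univ u)
      hu.frequently
    exact hz (this (Set.mem_univ z))
  have hFm : MeromorphicOn F (Metric.closedBall 0 R) := fun z _ => (hF.analyticAt z).meromorphicAt
  have hfin := (MeromorphicOn.divisor F (Metric.closedBall 0 R)).finiteSupport (isCompact_closedBall 0 R)
  have hnn : 0 ≤ MeromorphicOn.divisor F (Metric.closedBall 0 R) :=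
    MeromorphicOn.AnalyticOnNhd.divisor_nonneg (fun z _ => hF.analyticAt z)
  obtain ⟨g, hg, hg0, hFg⟩ := hFm.extract_zeros_poles (fun u => hord u) hfin
  have hlog := MeromorphicOn.extract_zeros_poles_log hg0 hFg
  set D := MeromorphicOn.divisor F (Metric.closedBall 0 R) with hD
  have hsum : (∑ᶠ (u : ℂ), fun x => ((D u : ℤ) : ℝ) * Real.log ‖x - u‖) =
      fun x => ∑ u ∈ hfin.toFinset, ((D u : ℤ) : ℝ) * Real.log ‖x - u‖ := by
    rw [finsum_eq_sum_of_support_subset (s := hfin.toFinset)]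
    · ext x; simp
    · intro u hu
      simp only [Set.Finite.coe_toFinset, Function.mem_support] at hu ⊢
      intro h
      apply hu
      ext x
      simp [h]
  rw [hsum] at hlog
  intro w0 hw0
  have hS := hlog
  rw [Filter.EventuallyEq, Filter.Eventually, mem_codiscreteWithin] at hS
  have hS0 := hS w0 (Metric.ball_subset_closedBall hw0)
  rw [Filter.disjoint_principal_right] at hS0
  have hb : Metric.ball (0:ℂ) R ∈ 𝓝[≠] w0 := nhdsWithin_le_nhds (Metric.isOpen_ball.mem_nhds hw0)
  have hnotin : ∀ᶠ w in 𝓝[≠] w0, ∀ u ∈ hfin.toFinset, w ≠ u := by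
    rw [Filter.eventually_all_finset]
    intro u _
    by_cases h : w0 = u
    · subst h; exact self_mem_nhdsWithin
    · exact nhdsWithin_le_nhds (isOpen_ne.mem_nhds h)
  filter_upwards [hS0, hb, hnotin] with w hw1 hw hw3
  have hw2 : Real.log ‖F w‖ = (∑ u ∈ hfin.toFinset, ((D u : ℤ) : ℝ) * Real.log ‖w - u‖) + Real.log ‖g w‖ := by
    by_contra hne
    exact hw1 ⟨Metric.ball_subset_closedBall hw, by simpa using hne⟩
  have hsph : Metric.sphere (0:ℂ) |R| ⊆ Metric.closedBall 0 R := by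
    rw [abs_of_pos hR]; exact Metric.sphere_subset_closedBall
  have hav : Real.circleAverage (PK w * fun z => Real.log ‖F z‖) 0 R =
      Real.circleAverage (fun z => (∑ u ∈ hfin.toFinset, (((D u : ℤ) : ℝ) • (PK w * fun z => Real.log ‖z - u‖)) z)
        + (PK w * fun z => Real.log ‖g z‖) z) 0 R := by
    apply Real.circleAverage_congr_codiscreteWithin _ hR.ne'
    have := hlog.filter_mono (Filter.codiscreteWithin_mono hsph)
    filter_upwards [this] with z hz
    simp only [Pi.mul_apply, hz, Pi.add_apply, Pi.smul_apply, smul_eq_mul]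
    rw [mul_add, Finset.mul_sum]
    congr 1
    apply Finset.sum_congr rfl
    intros; ring
  have hci : ∀ u, CircleIntegrable (PK w * fun z => Real.log ‖z - u‖) 0 R := fun u =>
    (circleIntegrable_log_norm_sub_const R).continuousOn_mul (PK_cont hw)
  have hcig : CircleIntegrable (PK w * fun z => Real.log ‖g z‖) 0 R :=
    (MeromorphicOn.circleIntegrable_log_norm
      (fun z hz => (hg z (hsph hz)).meromorphicAt)).continuousOn_mul (PK_cont hw)
  rw [hav, Real.circleAverage_fun_add (CircleIntegrable.fun_sum _ fun u _ => (hci u).const_smul) hcig,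
    Real.circleAverage_fun_sum (f := fun u => ((D u : ℤ) : ℝ) • (PK w * fun z => Real.log ‖z - u‖))
      (fun u _ => (hci u).const_smul), hw2,
    PK_harm hw hg (fun z hz => hg0 ⟨z, hz⟩)]
  gcongr with u hu
  rw [Real.circleAverage_smul, smul_eq_mul]
  apply mul_le_mul_of_nonneg_left
  · apply PK_lin hw _ (hw3 u hu)
    have : u ∈ D.support := by simpa using hu
    exact D.supportWithinDomain this
  · exact_mod_cast hnn u

theorem PK_bound {F : ℂ → ℂ} (hF : Differentiable ℂ F) {R : ℝ} (w0 : ℂ)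
    (hw0 : w0 ∈ Metric.ball (0:ℂ) (R/2)) :
    ‖F w0‖ ≤ Real.exp (3 * Real.circleAverage (fun z => Real.posLog ‖F z‖) 0 R) := by
  have hR : 0 < R := by have := Metric.pos_of_mem_ball hw0; linarith
  by_cases hF0 : ∃ z, F z ≠ 0
  swap
  · push Not at hF0
    rw [hF0, norm_zero]; positivity
  have hmer : MeromorphicOn F (Metric.sphere 0 |R|) := fun z _ => (hF.analyticAt z).meromorphicAt
  have hev := PK_sub hF hF0 hR w0 (Metric.ball_subset_ball (by linarith) hw0)
  have hb : Metric.ball (0:ℂ) (R/2) ∈ 𝓝[≠] w0 := nhdsWithin_le_nhds (Metric.isOpen_ball.mem_nhds hw0)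
  have hcont : Tendsto (fun w => ‖F w‖) (𝓝[≠] w0) (𝓝 ‖F w0‖) :=
    (hF.continuous.norm.tendsto w0).mono_left nhdsWithin_le_nhds
  refine le_of_tendsto hcont ?_
  filter_upwards [hev, hb] with w hw hwb
  have hwb' : w ∈ Metric.ball (0:ℂ) R := Metric.ball_subset_ball (by linarith) hwb
  by_cases h0 : F w = 0
  · rw [h0, norm_zero]; positivity
  rw [← Real.exp_log (norm_pos_iff.2 h0)]
  apply Real.exp_le_exp.2
  refine hw.trans ?_
  rw [← smul_eq_mul (3:ℝ), ← Real.circleAverage_smul]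
  apply Real.circleAverage_mono
  · exact (MeromorphicOn.circleIntegrable_log_norm hmer).continuousOn_mul (PK_cont hwb')
  · exact (MeromorphicOn.circleIntegrable_posLog_norm hmer).const_smul
  · intro z hz
    rw [abs_of_pos hR] at hz
    simp only [Pi.mul_apply, Pi.smul_apply, smul_eq_mul]
    calc _ ≤ PK w z * Real.posLog ‖F z‖ := by
          apply mul_le_mul_of_nonneg_left _ (PK_nonneg hwb' hz)
          rw [Real.posLog]; exact le_max_right _ _
      _ ≤ _ := mul_le_mul_of_nonneg_right (PK_le hwb hz) Real.posLog_nonneg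

/-- polynomially bounded at infinity -/
def PB (φ : ℝ → ℝ) : Prop := ∃ N : ℕ, ∀ᶠ r in atTop, φ r ≤ r ^ N

theorem PB.mono {φ ψ : ℝ → ℝ} (h : PB ψ) (hle : ∀ᶠ r in atTop, φ r ≤ ψ r) : PB φ := by
  obtain ⟨N, hN⟩ := h
  exact ⟨N, by filter_upwards [hN, hle] with r a b using b.trans a⟩

theorem PB.add {φ ψ : ℝ → ℝ} (h : PB φ) (h' : PB ψ) : PB (fun r => φ r + ψ r) := by
  obtain ⟨N, hN⟩ := h
  obtain ⟨M, hM⟩ := h'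
  refine ⟨max N M + 1, ?_⟩
  filter_upwards [hN, hM, eventually_ge_atTop 2] with r a b hr
  have h1 : r ^ N ≤ r ^ max N M := pow_le_pow_right₀ (by linarith) (le_max_left _ _)
  have h2 : r ^ M ≤ r ^ max N M := pow_le_pow_right₀ (by linarith) (le_max_right _ _)
  rw [pow_succ]
  have : 0 ≤ r ^ max N M := by positivity
  nlinarith

theorem PB.poly (C : ℝ) (N : ℕ) : PB (fun r => C * (1 + r) ^ N) := by
  refine ⟨N + 1, ?_⟩
  filter_upwards [eventually_ge_atTop (|C| * 2 ^ N), eventually_ge_atTop 1] with r h1 h2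
  calc C * (1 + r) ^ N ≤ |C| * (2 * r) ^ N := by
        gcongr
        · exact le_abs_self C
        · linarith
    _ = (|C| * 2 ^ N) * r ^ N := by rw [mul_pow]; ring
    _ ≤ r * r ^ N := by gcongr
    _ = _ := by ring

theorem PB.const (C : ℝ) : PB (fun _ => C) := by
  have := PB.poly C 0
  simpa using this

theorem PB.const_mul {φ : ℝ → ℝ} (h : PB φ) {C : ℝ} (hC : 0 ≤ C) : PB (fun r => C * φ r) := by
  obtain ⟨N, hN⟩ := h
  apply (PB.poly C N).mono
  filter_upwards [hN, eventually_ge_atTop 0] with r a b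
  gcongr
  exact a.trans (by gcongr; linarith)

/-- entire and of finite order -/
def EB (F : ℂ → ℂ) : Prop :=
  Differentiable ℂ F ∧ ∃ (C : ℝ) (N : ℕ), 0 ≤ C ∧ ∀ z, ‖F z‖ ≤ Real.exp (C * (1 + ‖z‖) ^ N)

theorem EB.of_PB {F : ℂ → ℂ} (hF : Differentiable ℂ F)
    (h : PB (fun r => Real.circleAverage (fun z => Real.posLog ‖F z‖) 0 r)) : EB F := by
  refine ⟨hF, ?_⟩
  obtain ⟨N, hN⟩ := h
  obtain ⟨r0, hr0⟩ := eventually_atTop.1 hN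
  refine ⟨3 * (3 + |r0|) ^ N, N, by positivity, fun z => ?_⟩
  have h1 := PK_bound hF (R := 2 * ‖z‖ + 2 + |r0|) z (by
    simp; linarith [abs_nonneg r0])
  refine h1.trans (Real.exp_le_exp.2 ?_)
  have h2 := hr0 (2 * ‖z‖ + 2 + |r0|) (by linarith [le_abs_self r0, norm_nonneg z])
  calc _ ≤ 3 * (2 * ‖z‖ + 2 + |r0|) ^ N := by linarith
    _ ≤ 3 * ((3 + |r0|) * (1 + ‖z‖)) ^ N := by
      have := norm_nonneg z
      have := abs_nonneg r0
      gcongr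
      nlinarith
    _ = _ := by rw [mul_pow]; ring

theorem EB.PB {F : ℂ → ℂ} (h : EB F) :
    PB (fun r => Real.circleAverage (fun z => Real.posLog ‖F z‖) 0 r) := by
  obtain ⟨hF, C, N, hC, hb⟩ := h
  apply (PB.poly C N).mono
  filter_upwards [eventually_ge_atTop 0] with r hr
  have hmer : MeromorphicOn F (Metric.sphere 0 |r|) := fun z _ => (hF.analyticAt z).meromorphicAt
  rw [← Real.circleAverage_const (C * (1 + r) ^ N) 0 r]
  apply Real.circleAverage_mono (MeromorphicOn.circleIntegrable_posLog_norm hmer)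
    (circleIntegrable_const _ _ _)
  intro z hz
  rw [abs_of_nonneg hr] at hz
  simp at hz
  rw [Real.posLog]
  apply max_le (by positivity)
  by_cases h0 : F z = 0
  · simp [h0]; positivity
  · rw [Real.log_le_iff_le_exp (norm_pos_iff.2 h0), ← hz]
    exact hb z

theorem EB.raise {F : ℂ → ℂ} (h : EB F) : ∃ (C : ℝ) (N : ℕ), 0 ≤ C ∧ ∀ M ≥ N, ∀ z,
    ‖F z‖ ≤ Real.exp (C * (1 + ‖z‖) ^ M) := by
  obtain ⟨hF, C, N, hC, hb⟩ := h
  refine ⟨C, N, hC, fun M hM z => (hb z).trans (Real.exp_le_exp.2 ?_)⟩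
  gcongr
  linarith [norm_nonneg z]

theorem EB.mul {F G : ℂ → ℂ} (h : EB F) (h' : EB G) : EB (fun z => F z * G z) := by
  obtain ⟨C, N, hC, hb⟩ := h.raise
  obtain ⟨C', N', hC', hb'⟩ := h'.raise
  refine ⟨h.1.mul h'.1, C + C', max N N', by positivity, fun z => ?_⟩
  rw [norm_mul, add_mul, Real.exp_add]
  gcongr
  · exact hb _ (le_max_left _ _) z
  · exact hb' _ (le_max_right _ _) z

theorem EB.add {F G : ℂ → ℂ} (h : EB F) (h' : EB G) : EB (fun z => F z + G z) := by
  obtain ⟨C, N, hC, hb⟩ := h.raise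
  obtain ⟨C', N', hC', hb'⟩ := h'.raise
  refine ⟨h.1.add h'.1, 1 + (C + C'), max N N', by positivity, fun z => ?_⟩
  have h1 := hb _ (le_max_left N N') z
  have h2 := hb' _ (le_max_right N N') z
  set X := (1 + ‖z‖) ^ max N N' with hX
  have hX1 : 1 ≤ X := one_le_pow₀ (by linarith [norm_nonneg z])
  have h3 : Real.exp (C * X) ≤ Real.exp ((C + C') * X) := Real.exp_le_exp.2 (by nlinarith)
  have h4 : Real.exp (C' * X) ≤ Real.exp ((C + C') * X) := Real.exp_le_exp.2 (by nlinarith)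
  have h5 : 2 ≤ Real.exp X := by
    have := Real.add_one_le_exp X
    linarith
  rw [add_mul, one_mul, Real.exp_add]
  have := norm_add_le (F z) (G z)
  nlinarith [Real.exp_pos ((C + C') * X)]

theorem EB.const (c : ℂ) : EB (fun _ => c) := by
  refine ⟨by fun_prop, ‖c‖, 0, norm_nonneg _, fun z => ?_⟩
  have := Real.add_one_le_exp ‖c‖
  simp; linarith

theorem EB.id : EB (fun z => z) := by
  refine ⟨by fun_prop, 1, 1, by norm_num, fun z => ?_⟩
  have := Real.add_one_le_exp (1 + ‖z‖)
  simp only [one_mul, pow_one]; linarith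

theorem EB.pow {F : ℂ → ℂ} (h : EB F) (n : ℕ) : EB (fun z => F z ^ n) := by
  induction n with
  | zero => simpa using EB.const 1
  | succ n ih => simpa [pow_succ] using ih.mul h

theorem EB.neg {F : ℂ → ℂ} (h : EB F) : EB (fun z => - F z) := by
  simpa using (EB.const (-1)).mul h

theorem EB.sub {F G : ℂ → ℂ} (h : EB F) (h' : EB G) : EB (fun z => F z - G z) := by
  simpa [sub_eq_add_neg] using h.add h'.neg

theorem EB.poly (p : Polynomial ℂ) : EB (fun z => p.eval z) := by
  induction p using Polynomial.induction_on' with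
  | add p q hp hq => simpa using hp.add hq
  | monomial n a => simpa using (EB.const a).mul (EB.id.pow n)

theorem EB.deriv {F : ℂ → ℂ} (h : EB F) : EB (deriv F) := by
  obtain ⟨hF, C, N, hC, hb⟩ := h
  refine ⟨fun z => (hF.analyticAt z).deriv.differentiableAt, C * 2 ^ N, N, by positivity, fun z => ?_⟩
  have := Complex.norm_deriv_le_of_forall_mem_sphere_norm_le (f := F) (c := z) (R := 1)
    (C := Real.exp (C * 2 ^ N * (1 + ‖z‖) ^ N)) one_pos (hF.diffContOnCl) (by
      intro w hw
      refine (hb w).trans (Real.exp_le_exp.2 ?_)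
      rw [mul_assoc, ← mul_pow]
      have h1 : ‖w‖ ≤ ‖z‖ + 1 := by
        have := norm_add_le z (w - z)
        simp at hw
        rw [hw] at this
        simpa using this
      have := norm_nonneg z
      gcongr
      linarith)
  simpa using this

theorem mtilde_differentiable {F : ℂ → ℂ} (h : Differentiable ℂ F) : Differentiable ℂ (mtilde F) := by
  intro z
  have := (h ((starRingEnd ℂ) z)).conj_conj
  rw [Complex.conj_conj] at this
  exact this

theorem EB.tilde {F : ℂ → ℂ} (h : EB F) : EB (mtilde F) := by
  obtain ⟨hF, C, N, hC, hb⟩ := h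
  refine ⟨mtilde_differentiable hF, C, N, hC, fun z => ?_⟩
  have := hb ((starRingEnd ℂ) z)
  simpa [mtilde] using this

/-- the codiscrete filter of the plane -/
noncomputable abbrev cod : Filter ℂ := codiscrete ℂ

theorem ev_cod_iff {p : ℂ → Prop} : (∀ᶠ z in cod, p z) ↔ ∀ z, ∀ᶠ w in 𝓝[≠] z, p w := by
  rw [Filter.Eventually, mem_codiscrete]
  constructor
  · intro h z
    have := h z
    rw [Filter.disjoint_principal_right, compl_compl] at this
    exact this
  · intro h z
    rw [Filter.disjoint_principal_right, compl_compl]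
    exact h z

instance cod_neBot : cod.NeBot := by
  rw [Filter.neBot_iff]
  intro h
  have h1 : ∀ᶠ z in cod, False := by rw [h]; trivial
  rw [ev_cod_iff] at h1
  have := (h1 0).exists
  simpa using this

theorem meroEq_iff {f g : ℂ → ℂ} : MeroEq f g ↔ f =ᶠ[cod] g := by
  rw [Filter.EventuallyEq, ev_cod_iff]; rfl

theorem cod_finite {S : Set ℂ} (h : S.Finite) : ∀ᶠ z in cod, z ∉ S :=
  h.compl_mem_codiscrete

theorem cod_ne (u : ℂ) : ∀ᶠ z in cod, z ≠ u := by
  have := cod_finite (Set.finite_singleton u)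
  simpa using this

theorem cod_entire_ne {F : ℂ → ℂ} (hF : Differentiable ℂ F) (h : ∃ z, F z ≠ 0) :
    ∀ᶠ z in cod, F z ≠ 0 := by
  obtain ⟨z, hz⟩ := h
  exact AnalyticOnNhd.preimage_zero_mem_codiscrete (fun z _ => hF.analyticAt z) hz

theorem cod_poly_ne {p : Polynomial ℂ} (hp : p ≠ 0) : ∀ᶠ z in cod, p.eval z ≠ 0 := by
  have := cod_finite (p.roots.toFinset.finite_toSet)
  filter_upwards [this] with z hz h
  apply hz
  simp [hp, h]

theorem cod_dense {p : ℂ → Prop} (h : ∀ᶠ z in cod, p z) : Dense {z | p z} := by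
  rw [ev_cod_iff] at h
  intro z
  rw [mem_closure_iff_frequently]
  have h1 : ∃ᶠ w in 𝓝[≠] z, p w := (h z).frequently
  exact h1.filter_mono nhdsWithin_le_nhds

theorem cod_eq {f g : ℂ → ℂ} (hf : Continuous f) (hg : Continuous g) (h : f =ᶠ[cod] g) : f = g :=
  Continuous.ext_on (cod_dense h) hf hg (fun _ hz => hz)

theorem cod_avg {f g : ℂ → ℝ} (h : f =ᶠ[cod] g) {r : ℝ} (hr : r ≠ 0) :
    Real.circleAverage f 0 r = Real.circleAverage g 0 r := by
  apply Real.circleAverage_congr_codiscreteWithin _ hr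
  exact h.filter_mono (Filter.codiscreteWithin_mono (Set.subset_univ _))

theorem poly_of_bound {u : ℂ → ℂ} (hu : Differentiable ℂ u) {C : ℝ} {N : ℕ}
    (h : ∀ z, ‖u z‖ ≤ C * (1 + ‖z‖) ^ N) : ∃ p : Polynomial ℂ, ∀ z, u z = p.eval z := by
  have hz : ∀ n > N, iteratedDeriv n u 0 = 0 := by
    intro n hn
    have hC : 0 ≤ C := by
      have := (norm_nonneg _).trans (h 0)
      simpa using this
    have hb : ∀ R : ℝ, 1 ≤ R → ‖iteratedDeriv n u 0‖ ≤ (n.factorial * (C * 2 ^ N)) * R⁻¹ := by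
      intro R hR
      have := Complex.norm_iteratedDeriv_le_of_forall_mem_sphere_norm_le (f := u) (c := 0) (R := R)
        (C := C * (2 * R) ^ N) n (by linarith) hu.diffContOnCl (by
          intro z hz
          simp at hz
          refine (h z).trans ?_
          rw [hz]
          gcongr
          linarith)
      refine this.trans ?_
      have hR0 : 0 < R := by linarith
      rw [div_le_iff₀ (by positivity)]
      have h1 : R ^ N * R ≤ R ^ n := by
        rw [← pow_succ]; exact pow_le_pow_right₀ hR hn
      have h2 : R ^ N ≤ R⁻¹ * R ^ n := by
        rw [inv_mul_eq_div, le_div_iff₀ hR0]; exact h1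
      calc _ = (n.factorial * (C * 2 ^ N)) * R ^ N := by rw [mul_pow]; ring
        _ ≤ (n.factorial * (C * 2 ^ N)) * (R⁻¹ * R ^ n) := by gcongr
        _ = _ := by ring
    have hlim : Tendsto (fun R : ℝ => (n.factorial * (C * 2 ^ N)) * R⁻¹) atTop (𝓝 0) := by
      have := tendsto_inv_atTop_zero.const_mul ((n.factorial * (C * 2 ^ N)) : ℝ)
      simpa using this
    have := ge_of_tendsto hlim (by filter_upwards [eventually_ge_atTop 1] with R hR using hb R hR)
    exact norm_le_zero_iff.1 this
  refine ⟨∑ n ∈ Finset.range (N + 1), Polynomial.C ((n.factorial : ℂ)⁻¹ * iteratedDeriv n u 0) * Polynomial.X ^ n, fun z => ?_⟩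
  rw [← Complex.taylorSeries_eq_of_entire' 0 z hu, tsum_eq_sum (s := Finset.range (N + 1))]
  · simp [Polynomial.eval_finsetSum]
  · intro n hn
    simp at hn
    rw [hz n (by omega)]; simp

theorem exp_of_ne_zero {H : ℂ → ℂ} (hH : Differentiable ℂ H) (h0 : ∀ z, H z ≠ 0) :
    ∃ u : ℂ → ℂ, Differentiable ℂ u ∧ ∀ z, H z = Complex.exp (u z) := by
  have hd : Differentiable ℂ (fun z => deriv H z / H z) := fun z =>
    ((hH.analyticAt z).deriv.differentiableAt).div (hH z) (h0 z)
  obtain ⟨u, hu0, hu⟩ := hd.isExactOn_univ.with_val_at 0 (Complex.log (H 0))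
  have hud : Differentiable ℂ u := fun z => (hu z trivial).differentiableAt
  refine ⟨u, hud, ?_⟩
  have hk : ∀ z, HasDerivAt (fun z => H z * Complex.exp (-u z)) 0 z := by
    intro z
    have h1 := (hH z).hasDerivAt.mul ((hu z trivial).neg.cexp)
    have h2 : (0:ℂ) = deriv H z * Complex.exp (-u z) + H z * (Complex.exp (-u z) * -(deriv H z / H z)) := by
      have h3 : H z * (deriv H z / H z) = deriv H z := mul_div_cancel₀ _ (h0 z)
      linear_combination Complex.exp (-u z) * h3
    rw [h2]
    exact h1
  have hc := is_const_of_deriv_eq_zero (𝕜 := ℂ) (f := fun z => H z * Complex.exp (-u z))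
    (fun z => (hk z).differentiableAt) (fun z => (hk z).deriv)
  intro z
  have h2 := hc z 0
  simp only [hu0, Complex.exp_neg, Complex.exp_log (h0 0)] at h2
  rw [mul_inv_cancel₀ (h0 0)] at h2
  field_simp at h2
  exact h2

theorem EB.exp_poly {H : ℂ → ℂ} (hH : EB H) (h0 : ∀ z, H z ≠ 0) :
    ∃ P : Polynomial ℂ, ∀ z, H z = Complex.exp (P.eval z) := by
  obtain ⟨u, hu, hHu⟩ := exp_of_ne_zero hH.1 h0
  obtain ⟨-, C, N, hC, hb⟩ := hH
  have hre : ∀ z, (u z).re ≤ C * (1 + ‖z‖) ^ N := by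
    intro z
    have := hb z
    rw [hHu z, Complex.norm_exp] at this
    exact Real.exp_le_exp.1 this
  have hbd : ∀ z, ‖u z‖ ≤ (2 * ((C + 1) * 3 ^ N) + 3 * ‖u 0‖) * (1 + ‖z‖) ^ N := by
    intro z
    set R := 2 * ‖z‖ + 1 with hR
    have hz0 := norm_nonneg z
    have hM : 0 < (C + 1) * (1 + R) ^ N := by positivity
    have := Complex.borelCaratheodory (f := u) (M := (C + 1) * (1 + R) ^ N) (R := R) (z := z) hM
      hu.differentiableOn (by
        intro w hw
        simp only [Metric.mem_ball, dist_zero_right] at hw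
        refine (hre w).trans ?_
        gcongr
        linarith) (by positivity) (by simp; linarith)
    refine this.trans ?_
    have h1 : R - ‖z‖ = ‖z‖ + 1 := by rw [hR]; ring
    have h2 : R + ‖z‖ ≤ 3 * (‖z‖ + 1) := by rw [hR]; linarith
    rw [h1]
    have h3 : (1 + R) ^ N ≤ 3 ^ N * (1 + ‖z‖) ^ N := by
      rw [← mul_pow]; gcongr; rw [hR]; linarith
    have h4 : 1 ≤ (1 + ‖z‖) ^ N := one_le_pow₀ (by linarith)
    have h5 : 2 * ((C + 1) * (1 + R) ^ N) * ‖z‖ / (‖z‖ + 1) ≤ 2 * ((C + 1) * (1 + R) ^ N) := by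
      rw [div_le_iff₀ (by positivity)]; nlinarith
    have h6 : ‖u 0‖ * (R + ‖z‖) / (‖z‖ + 1) ≤ 3 * ‖u 0‖ := by
      rw [div_le_iff₀ (by positivity)]; nlinarith [norm_nonneg (u 0)]
    have h7 : (C + 1) * (1 + R) ^ N ≤ (C + 1) * (3 ^ N * (1 + ‖z‖) ^ N) := by gcongr
    nlinarith [norm_nonneg (u 0)]
  obtain ⟨P, hP⟩ := poly_of_bound hu hbd
  exact ⟨P, fun z => by rw [hHu z, hP z]⟩

theorem EB.PB_inv {F : ℂ → ℂ} (h : EB F) (h0 : ∃ z, F z ≠ 0) :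
    _root_.PB (fun r => Real.circleAverage (fun z => Real.posLog ‖F z‖⁻¹) 0 r) := by
  have hF := h.1
  have hne := cod_entire_ne hF h0
  have hm : ∀ U, MeromorphicOn F U := fun U z _ => (hF.analyticAt z).meromorphicAt
  have hpb := h.PB.add (PB.const (-Real.log ‖meromorphicTrailingCoeffAt F 0‖))
  apply hpb.mono
  filter_upwards [eventually_ge_atTop 1] with r hr
  have hr0 : 0 < r := by linarith
  have e : (fun z => Real.posLog ‖F z‖⁻¹) =
      (fun z => Real.posLog ‖F z‖) + (-1 : ℝ) • (fun z => Real.log ‖F z‖) := by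
    ext z
    have := Real.posLog_sub_posLog_inv (x := ‖F z‖)
    simp only [Pi.add_apply, Pi.smul_apply, smul_eq_mul]
    linarith
  rw [e, Real.circleAverage_add (MeromorphicOn.circleIntegrable_posLog_norm (hm _))
    (MeromorphicOn.circleIntegrable_log_norm (hm _)).const_smul, Real.circleAverage_smul,
    (hm _).circleAverage_log_norm hr0.ne']
  have hnn : 0 ≤ MeromorphicOn.divisor F (Metric.closedBall 0 |r|) :=
    MeromorphicOn.AnalyticOnNhd.divisor_nonneg (fun z _ => hF.analyticAt z)
  have h1 : 0 ≤ ∑ᶠ u, (MeromorphicOn.divisor F (Metric.closedBall 0 |r|) u : ℝ) * Real.log (r * ‖0 - u‖⁻¹) := by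
    apply finsum_nonneg
    intro u
    have h2 : (0:ℝ) ≤ (MeromorphicOn.divisor F (Metric.closedBall 0 |r|) u : ℝ) := by exact_mod_cast hnn u
    by_cases hu : u ∈ Metric.closedBall (0:ℂ) |r|
    · apply mul_nonneg h2
      rw [abs_of_pos hr0] at hu
      simp at hu
      by_cases hu0 : u = 0
      · simp [hu0]
      · apply Real.log_nonneg
        have : 0 < ‖u‖ := norm_pos_iff.2 hu0
        rw [zero_sub, norm_neg, ← div_eq_mul_inv, le_div_iff₀ this]
        linarith
    · rw [Function.locallyFinsuppWithin.apply_eq_zero_of_notMem _ hu]; simp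
  have h3 : 0 ≤ (MeromorphicOn.divisor F (Metric.closedBall 0 |r|) 0 : ℝ) * Real.log r :=
    mul_nonneg (by exact_mod_cast hnn 0) (Real.log_nonneg hr)
  simp only [smul_eq_mul]
  linarith

theorem EB.quot {F G H : ℂ → ℂ} (hF : EB F) (hG : EB G) (hG0 : ∃ z, G z ≠ 0) (hH : Differentiable ℂ H)
    (h : ∀ z, F z = G z * H z) : EB H := by
  apply EB.of_PB hH
  apply (hF.PB.add (hG.PB_inv hG0)).mono
  filter_upwards [eventually_gt_atTop 0] with r hr
  have hmF : ∀ U, MeromorphicOn F U := fun U z _ => (hF.1.analyticAt z).meromorphicAt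
  have hmG : ∀ U, MeromorphicOn G⁻¹ U := fun U z _ => (hG.1.analyticAt z).meromorphicAt.inv
  have i1 : CircleIntegrable (fun z => Real.posLog ‖F z‖) 0 r := MeromorphicOn.circleIntegrable_posLog_norm (hmF _)
  have i2 : CircleIntegrable (fun z => Real.posLog ‖G z‖⁻¹) 0 r := by
    have := MeromorphicOn.circleIntegrable_posLog_norm (hmG (Metric.sphere 0 |r|))
    simpa using this
  have e : (fun z => Real.posLog ‖H z‖) =ᶠ[cod] fun z => Real.posLog ‖F z * (G z)⁻¹‖ := by
    filter_upwards [cod_entire_ne hG.1 hG0] with z hz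
    rw [h z]
    congr 2
    field_simp
  rw [cod_avg e hr.ne', ← Real.circleAverage_fun_add i1 i2]
  apply Real.circleAverage_mono
  · exact MeromorphicOn.circleIntegrable_posLog_norm ((hmF _).mul (hmG _))
  · exact i1.add i2
  · intro z _
    rw [norm_mul, norm_inv]
    exact Real.posLog_mul

theorem hadamard_lite {F G : ℂ → ℂ} (hF : EB F) (hG : EB G) (hF0 : ∃ z, F z ≠ 0) (hG0 : ∃ z, G z ≠ 0)
    (hfin : {z | meromorphicOrderAt (fun z => F z / G z) z ≠ 0}.Finite) :
    ∃ a b P : Polynomial ℂ, a ≠ 0 ∧ b ≠ 0 ∧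
      ∀ z, F z * b.eval z = G z * a.eval z * Complex.exp (P.eval z) := by
  set q : ℂ → ℂ := fun z => F z / G z with hq
  have hm : MeromorphicOn q Set.univ := fun z _ =>
    (hF.1.analyticAt z).meromorphicAt.div (hG.1.analyticAt z).meromorphicAt
  have hne : ∀ᶠ z in cod, q z ≠ 0 := by
    filter_upwards [cod_entire_ne hF.1 hF0, cod_entire_ne hG.1 hG0] with z h1 h2
    exact div_ne_zero h1 h2
  have hord : ∀ u, meromorphicOrderAt q u ≠ ⊤ := by
    intro u hu
    rw [meromorphicOrderAt_eq_top_iff] at hu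
    obtain ⟨z, h1, h2⟩ := (((ev_cod_iff.1 hne) u).and hu).exists
    exact h1 h2
  have hD : (MeromorphicOn.divisor q Set.univ).support.Finite := by
    refine hfin.subset ?_
    intro z hz
    rw [Function.mem_support, MeromorphicOn.divisor_apply hm (Set.mem_univ z)] at hz
    intro h
    apply hz
    rw [h]; rfl
  obtain ⟨H, hH, hH0, hqH⟩ := hm.extract_zeros_poles (fun u => hord u) hD
  set D := MeromorphicOn.divisor q Set.univ
  have hprod : (∏ᶠ (u : ℂ), (fun x : ℂ => x - u) ^ D u) = ∏ u ∈ hD.toFinset, (fun x : ℂ => x - u) ^ D u := by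
    apply finprod_eq_prod_of_mulSupport_subset
    intro u hu
    simp only [Set.Finite.coe_toFinset, Function.mem_support]
    intro h
    apply hu
    simp only [h, zpow_zero]
  rw [hprod] at hqH
  have hHd : Differentiable ℂ H := fun z => (hH z trivial).differentiableAt
  set a : Polynomial ℂ := ∏ u ∈ hD.toFinset, (Polynomial.X - Polynomial.C u) ^ (D u).toNat with ha
  set b : Polynomial ℂ := ∏ u ∈ hD.toFinset, (Polynomial.X - Polynomial.C u) ^ (-D u).toNat with hb
  have ha0 : a ≠ 0 := Finset.prod_ne_zero_iff.2 fun u _ => pow_ne_zero _ (Polynomial.X_sub_C_ne_zero u)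
  have hb0 : b ≠ 0 := Finset.prod_ne_zero_iff.2 fun u _ => pow_ne_zero _ (Polynomial.X_sub_C_ne_zero u)
  have hcod : (fun z => F z * b.eval z) =ᶠ[cod] fun z => (G z * a.eval z) * H z := by
    filter_upwards [hqH, cod_entire_ne hG.1 hG0, cod_finite hD] with z hz hGz hzD
    have h1 : (∏ u ∈ hD.toFinset, (z - u) ^ D u) * b.eval z = a.eval z := by
      rw [ha, hb, Polynomial.eval_prod, Polynomial.eval_prod, ← Finset.prod_mul_distrib]
      apply Finset.prod_congr rfl
      intro u hu
      have hzu : z - u ≠ 0 := by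
        intro h
        apply hzD
        have : z = u := by linear_combination h
        rw [this]; simpa using hu
      simp only [Polynomial.eval_pow, Polynomial.eval_sub, Polynomial.eval_X, Polynomial.eval_C]
      rw [← zpow_natCast, ← zpow_natCast, ← zpow_add₀ hzu]
      congr 1
      omega
    have h2 : q z = (∏ u ∈ hD.toFinset, (z - u) ^ D u) * H z := by
      rw [hz]; simp [Finset.prod_apply]
    have h3 : F z = q z * G z := by rw [hq]; field_simp
    rw [h3, h2, ← h1]; ring
  have hall := cod_eq (hF.1.continuous.mul b.continuous)
    ((hG.1.continuous.mul a.continuous).mul hHd.continuous) hcod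
  have hGa0 : ∃ z, G z * a.eval z ≠ 0 := by
    obtain ⟨z, h1, h2⟩ := ((cod_entire_ne hG.1 hG0).and (cod_poly_ne ha0)).exists
    exact ⟨z, mul_ne_zero h1 h2⟩
  have hHE : EB H := EB.quot (hF.mul (EB.poly b)) (hG.mul (EB.poly a)) hGa0 hHd (fun z => congrFun hall z)
  obtain ⟨P, hP⟩ := hHE.exp_poly (fun z => hH0 ⟨z, trivial⟩)
  exact ⟨a, b, P, ha0, hb0, fun z => by rw [← hP z]; exact congrFun hall z⟩

theorem cod_nhds {p : ℂ → Prop} (h : ∀ᶠ z in cod, p z) : ∀ᶠ z in cod, ∀ᶠ w in 𝓝 z, p w := by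
  have ho : IsOpen {z | p z} := (mem_codiscrete'.1 h).1
  filter_upwards [h] with z hz
  exact ho.mem_nhds hz

theorem cod_deriv {f g : ℂ → ℂ} (h : f =ᶠ[cod] g) : deriv f =ᶠ[cod] deriv g := by
  filter_upwards [cod_nhds h] with z hz
  exact Filter.EventuallyEq.deriv_eq hz

theorem tendsto_conj_nhdsNE (z : ℂ) :
    Tendsto (starRingEnd ℂ) (𝓝[≠] z) (𝓝[≠] ((starRingEnd ℂ) z)) := by
  rw [tendsto_nhdsWithin_iff]
  refine ⟨(Complex.continuous_conj.tendsto z).mono_left nhdsWithin_le_nhds, ?_⟩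
  filter_upwards [self_mem_nhdsWithin] with w hw h
  exact hw ((starRingEnd ℂ).injective h)

theorem tendsto_conj_cod : Tendsto (starRingEnd ℂ) cod cod := by
  intro S hS
  have h : ∀ᶠ z in cod, z ∈ S := hS
  rw [ev_cod_iff] at h
  change ∀ᶠ z in cod, (starRingEnd ℂ) z ∈ S
  rw [ev_cod_iff]
  intro z
  exact (tendsto_conj_nhdsNE z).eventually (h _)

theorem cod_mtilde {f g : ℂ → ℂ} (h : f =ᶠ[cod] g) : mtilde f =ᶠ[cod] mtilde g := by
  filter_upwards [tendsto_conj_cod.eventually h] with z hz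
  simp [mtilde, hz]

theorem mtilde_mtilde (f : ℂ → ℂ) : mtilde (mtilde f) = f := by
  ext z; simp [mtilde]

theorem deriv_mtilde (f : ℂ → ℂ) : deriv (mtilde f) = mtilde (deriv f) := deriv_conj_conj

theorem mtilde_analyticAt {f : ℂ → ℂ} {z : ℂ} (h : AnalyticAt ℂ f ((starRingEnd ℂ) z)) :
    AnalyticAt ℂ (mtilde f) z := by
  rw [Complex.analyticAt_iff_eventually_differentiableAt] at h ⊢
  filter_upwards [(Complex.continuous_conj.tendsto z).eventually h] with w hw
  have := hw.conj_conj
  rw [Complex.conj_conj] at this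
  exact this

theorem mtilde_meromorphicAt {f : ℂ → ℂ} {z : ℂ} (h : MeromorphicAt f ((starRingEnd ℂ) z)) :
    MeromorphicAt (mtilde f) z := by
  obtain ⟨n, hn⟩ := h
  refine ⟨n, ?_⟩
  have e : (fun w => (w - z) ^ n • mtilde f w) =
      mtilde (fun w => (w - (starRingEnd ℂ) z) ^ n • f w) := by
    ext w
    simp [mtilde]
  rw [e]
  exact mtilde_analyticAt hn

theorem mtilde_order {f : ℂ → ℂ} {z : ℂ} (h : MeromorphicAt f ((starRingEnd ℂ) z)) :
    meromorphicOrderAt (mtilde f) z = meromorphicOrderAt f ((starRingEnd ℂ) z) := by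
  rcases ho : meromorphicOrderAt f ((starRingEnd ℂ) z) with _ | n
  · change _ = ⊤ at ho
    change _ = ⊤
    rw [meromorphicOrderAt_eq_top_iff] at ho ⊢
    filter_upwards [(tendsto_conj_nhdsNE z).eventually ho] with w hw
    simp [mtilde, hw]
  · change _ = ((n:ℤ) : WithTop ℤ) at ho
    change _ = ((n:ℤ) : WithTop ℤ)
    rw [meromorphicOrderAt_eq_int_iff h] at ho
    rw [meromorphicOrderAt_eq_int_iff (mtilde_meromorphicAt h)]
    obtain ⟨g, hg, hg0, he⟩ := ho
    refine ⟨mtilde g, mtilde_analyticAt hg, by simpa [mtilde] using hg0, ?_⟩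
    filter_upwards [(tendsto_conj_nhdsNE z).eventually he] with w hw
    simp [mtilde, hw]

/-- quotient of a finite order entire function by a polynomial -/
def Nice (f : ℂ → ℂ) : Prop := ∃ (F : ℂ → ℂ) (q : Polynomial ℂ), EB F ∧ q ≠ 0 ∧
  f =ᶠ[cod] fun z => F z / q.eval z

theorem Nice.deriv {f : ℂ → ℂ} (h : Nice f) : Nice (deriv f) := by
  obtain ⟨F, q, hF, hq, he⟩ := h
  refine ⟨fun z => _root_.deriv F z * q.eval z - F z * q.derivative.eval z, q ^ 2,
    (hF.deriv.mul (EB.poly q)).sub (hF.mul (EB.poly _)), pow_ne_zero _ hq, ?_⟩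
  refine (cod_deriv he).trans ?_
  filter_upwards [cod_poly_ne hq] with z hz
  have := ((hF.1 z).hasDerivAt.div (q.hasDerivAt z) hz).deriv
  rw [Polynomial.eval_pow]
  exact this

/-- conjugate polynomial -/
noncomputable def ptilde (q : Polynomial ℂ) : Polynomial ℂ := q.map (starRingEnd ℂ)

theorem ptilde_eval (q : Polynomial ℂ) (z : ℂ) :
    (ptilde q).eval z = (starRingEnd ℂ) (q.eval ((starRingEnd ℂ) z)) := by
  have := Polynomial.eval_map_apply (p := q) (starRingEnd ℂ) ((starRingEnd ℂ) z)
  rw [Complex.conj_conj] at this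
  exact this

theorem ptilde_ne {q : Polynomial ℂ} (h : q ≠ 0) : ptilde q ≠ 0 :=
  (Polynomial.map_ne_zero_iff (starRingEnd ℂ).injective).2 h

theorem nice_of_finiteOrder {f : ℂ → ℂ} (hm : ∀ z, MeromorphicAt f z) (hord : FiniteOrder f)
    (hp : {z : ℂ | meroOrder f z < 0}.Finite) : Nice f := by
  choose n hn using hm
  set q : Polynomial ℂ := ∏ u ∈ hp.toFinset, (Polynomial.X - Polynomial.C u) ^ (n u) with hq
  have hq0 : q ≠ 0 := Finset.prod_ne_zero_iff.2 fun u _ => pow_ne_zero _ (Polynomial.X_sub_C_ne_zero u)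
  have hm' : ∀ z, MeromorphicAt f z := fun z => ⟨n z, hn z⟩
  have hqa : ∀ (p : Polynomial ℂ) (z : ℂ), AnalyticAt ℂ (fun z => p.eval z) z := fun p z =>
    p.differentiable.analyticAt z
  set h : ℂ → ℂ := f * (fun z => q.eval z) with hh
  have hhm : MeromorphicOn h Set.univ := fun z _ => (hm' z).mul (hqa q z).meromorphicAt
  have hho : ∀ z, 0 ≤ meromorphicOrderAt h z := by
    intro z
    by_cases hz : z ∈ hp.toFinset
    · have e : h = fun w => ((w - z) ^ n z • f w) *
          (∏ u ∈ hp.toFinset.erase z, (Polynomial.X - Polynomial.C u) ^ (n u)).eval w := by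
        ext w
        rw [hh, Pi.mul_apply, hq, ← Finset.mul_prod_erase _ _ hz]
        simp
        ring
      rw [e]
      exact AnalyticAt.meromorphicOrderAt_nonneg ((hn z).mul (hqa _ z))
    · rw [hh, meromorphicOrderAt_mul (hm' z) (hqa q z).meromorphicAt]
      refine add_nonneg ?_ (hqa q z).meromorphicOrderAt_nonneg
      simp [meroOrder, hm' z] at hz
      exact hz
  set F := toMeromorphicNFOn h Set.univ with hF
  have hFe : h =ᶠ[cod] F := toMeromorphicNFOn_eqOn_codiscrete hhm
  have hFd : Differentiable ℂ F := by
    intro z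
    have h1 : MeromorphicNFAt F z := meromorphicNFOn_toMeromorphicNFOn h Set.univ (Set.mem_univ z)
    refine (h1.meromorphicOrderAt_nonneg_iff_analyticAt.1 ?_).differentiableAt
    rw [hF, meromorphicOrderAt_toMeromorphicNFOn hhm (Set.mem_univ z)]
    exact hho z
  refine ⟨F, q, EB.of_PB hFd ?_, hq0, ?_⟩
  · have hpf : _root_.PB (fun r => Real.circleAverage (fun z => Real.posLog ‖f z‖) 0 r) := by
      obtain ⟨C, hC⟩ := hord
      refine ⟨⌈C⌉₊, ?_⟩
      filter_upwards [hC, eventually_ge_atTop 1] with r hr hr1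
      have hN : 0 ≤ NCount f r := by
        apply intervalIntegral.integral_nonneg hr1
        intro t ht
        apply div_nonneg _ (by linarith [ht.1])
        apply finsum_nonneg
        intro z
        apply finsum_nonneg
        intro _
        positivity
      have hpr : proximity f r = Real.circleAverage (fun z => Real.posLog ‖f z‖) 0 r := by
        unfold proximity Real.circleAverage
        simp only [smul_eq_mul]
        congr 2
        ext θ
        simp [logPlus, Real.posLog, circleMap, max_comm]
      rw [← hpr]
      unfold TChar at hr
      calc _ ≤ r ^ C := by linarith
        _ ≤ r ^ ((⌈C⌉₊ : ℕ) : ℝ) := Real.rpow_le_rpow_of_exponent_le hr1 (Nat.le_ceil C)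
        _ = _ := Real.rpow_natCast _ _
    apply (hpf.add (EB.poly q).PB).mono
    filter_upwards [eventually_gt_atTop 0] with r hr
    have e : (fun z => Real.posLog ‖F z‖) =ᶠ[cod] fun z => Real.posLog ‖f z * q.eval z‖ := by
      filter_upwards [hFe] with z hz
      rw [← hz]; rfl
    have i1 : CircleIntegrable (fun z => Real.posLog ‖f z‖) 0 r :=
      MeromorphicOn.circleIntegrable_posLog_norm (fun z _ => hm' z)
    have i2 : CircleIntegrable (fun z => Real.posLog ‖q.eval z‖) 0 r :=
      MeromorphicOn.circleIntegrable_posLog_norm (fun z _ => (hqa q z).meromorphicAt)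
    rw [cod_avg e hr.ne', ← Real.circleAverage_fun_add i1 i2]
    apply Real.circleAverage_mono
    · exact MeromorphicOn.circleIntegrable_posLog_norm (f := h) (fun z _ => hhm z trivial)
    · exact i1.add i2
    · intro z _
      rw [norm_mul]
      exact Real.posLog_mul
  · filter_upwards [hFe, cod_poly_ne hq0] with z h1 h2
    rw [← h1, hh, Pi.mul_apply]
    field_simp

theorem nonreal_infinite : ({z : ℂ | z.im ≠ 0}).Infinite := by
  intro h
  have h1 : (Set.range fun n : ℕ => ((n:ℂ) + Complex.I)) ⊆ {z : ℂ | z.im ≠ 0} := by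
    rintro _ ⟨n, rfl⟩; simp
  have h2 := h.subset h1
  refine Set.infinite_range_of_injective ?_ h2
  intro a b hab
  simpa using hab

theorem cod_ne_of_finite {φ : ℂ → ℂ} (hm : ∀ z, MeromorphicAt φ z) (hN : Nice φ)
    (hz : {z : ℂ | 0 < meroOrder φ z ∧ z.im ≠ 0}.Finite) : ∀ᶠ z in cod, φ z ≠ 0 := by
  obtain ⟨F, q, hF, hq, he⟩ := hN
  by_cases h0 : ∃ z, F z ≠ 0
  · filter_upwards [he, cod_entire_ne hF.1 h0, cod_poly_ne hq] with z h1 h2 h3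
    rw [h1]
    exact div_ne_zero h2 h3
  · push Not at h0
    exfalso
    apply nonreal_infinite
    refine hz.subset ?_
    intro z hzi
    refine ⟨?_, hzi⟩
    have : meromorphicOrderAt φ z = ⊤ := by
      rw [meromorphicOrderAt_eq_top_iff]
      filter_upwards [ev_cod_iff.1 he z] with w hw
      simp [hw, h0]
    simp [meroOrder, hm z, this]

theorem exists_S {φ : ℂ → ℂ} (hm : ∀ z, MeromorphicAt φ z) (hN : Nice φ)
    (hz : {z : ℂ | 0 < meroOrder φ z ∧ z.im ≠ 0}.Finite) :
    ∃ a b P : Polynomial ℂ, a ≠ 0 ∧ b ≠ 0 ∧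
      φ =ᶠ[cod] fun z => a.eval z / b.eval z * Complex.exp (P.eval z) * mtilde φ z := by
  have hne := cod_ne_of_finite hm hN hz
  obtain ⟨F, q, hF, hq, he⟩ := hN
  have he' : mtilde φ =ᶠ[cod] fun z => mtilde F z / (ptilde q).eval z := by
    filter_upwards [cod_mtilde he] with z h
    rw [h]
    simp [mtilde, ptilde_eval]
  have hF0 : ∃ z, F z * (ptilde q).eval z ≠ 0 := by
    obtain ⟨z, h1, h2, h3⟩ := (hne.and (he.and (cod_poly_ne (ptilde_ne hq)))).exists
    refine ⟨z, mul_ne_zero ?_ h3⟩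
    intro h
    rw [h2] at h1
    simp [h] at h1
  have hne' : ∀ᶠ z in cod, mtilde φ z ≠ 0 := by
    filter_upwards [tendsto_conj_cod.eventually hne] with z h
    simpa [mtilde] using h
  have hG0 : ∃ z, mtilde F z * q.eval z ≠ 0 := by
    obtain ⟨z, h1, h2, h3⟩ := (hne'.and (he'.and (cod_poly_ne hq))).exists
    refine ⟨z, mul_ne_zero ?_ h3⟩
    intro h
    rw [h2] at h1
    simp [h] at h1
  have hquot : (fun z => F z * (ptilde q).eval z / (mtilde F z * q.eval z)) =ᶠ[cod]
      φ * (mtilde φ)⁻¹ := by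
    filter_upwards [he, he', cod_poly_ne hq, cod_poly_ne (ptilde_ne hq)] with z h1 h2 h3 h4
    rw [Pi.mul_apply, Pi.inv_apply, h1, h2, inv_div, div_mul_div_comm, mul_comm (q.eval z)]
  set A : Set ℂ := {z : ℂ | 0 < meroOrder φ z ∧ z.im ≠ 0} ∪ (q.roots.toFinset : Set ℂ) with hA
  have hAf : A.Finite := hz.union (Finset.finite_toSet _)
  have hord0 : ∀ z : ℂ, z ∉ A → z.im ≠ 0 → meromorphicOrderAt φ z = 0 := by
    intro z hzA hzi
    simp only [hA, Set.mem_union, not_or] at hzA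
    have hqz : q.eval z ≠ 0 := by
      intro h; apply hzA.2; simp [hq, h]
    have h1 : 0 ≤ meromorphicOrderAt φ z := by
      rw [meromorphicOrderAt_congr (ev_cod_iff.1 he z)]
      apply AnalyticAt.meromorphicOrderAt_nonneg
      exact (hF.1.analyticAt z).div (q.differentiable.analyticAt z) hqz
    have h2 : ¬ 0 < meromorphicOrderAt φ z := by
      intro h
      apply hzA.1
      refine ⟨?_, hzi⟩
      simpa [meroOrder, hm z] using h
    exact le_antisymm (not_lt.1 h2) h1
  have hfin : {z | meromorphicOrderAt (fun z => F z * (ptilde q).eval z / (mtilde F z * q.eval z)) z ≠ 0}.Finite := by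
    refine (hAf.union (hAf.image (starRingEnd ℂ))).subset ?_
    intro z hz'
    by_contra hcon
    simp only [Set.mem_union, not_or] at hcon
    apply hz'
    rw [meromorphicOrderAt_congr (ev_cod_iff.1 hquot z),
      meromorphicOrderAt_mul (hm z) (mtilde_meromorphicAt (hm _)).inv, meromorphicOrderAt_inv,
      mtilde_order (hm _)]
    by_cases hzi : z.im = 0
    · have hcz : (starRingEnd ℂ) z = z := Complex.conj_eq_iff_im.2 hzi
      rw [hcz]
      have hnt : meromorphicOrderAt φ z ≠ ⊤ := by
        intro h
        rw [meromorphicOrderAt_eq_top_iff] at h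
        obtain ⟨w, h1, h2⟩ := ((ev_cod_iff.1 hne z).and h).exists
        exact h1 h2
      lift meromorphicOrderAt φ z to ℤ using hnt with k
      have : ((k:ℤ) : WithTop ℤ) + -((k : ℤ) : WithTop ℤ) = ((k + -k : ℤ) : WithTop ℤ) := rfl
      rw [this]; simp
    · rw [hord0 z hcon.1 hzi, hord0 ((starRingEnd ℂ) z) _ (by simpa using hzi)]
      · rfl
      · intro h
        exact hcon.2 ⟨_, h, by simp⟩
  obtain ⟨a, b, P, ha, hb, hab⟩ := hadamard_lite (hF.mul (EB.poly (ptilde q)))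
    (hF.tilde.mul (EB.poly q)) hF0 hG0 hfin
  refine ⟨a, b, P, ha, hb, ?_⟩
  filter_upwards [hquot, cod_poly_ne hb, hne', cod_entire_ne (hF.tilde.mul (EB.poly q)).1 hG0] with z h1 h2 h3 h4
  have h5 := hab z
  have h6 : φ z = F z * (ptilde q).eval z / (mtilde F z * q.eval z) * mtilde φ z := by
    rw [h1, Pi.mul_apply, Pi.inv_apply]; field_simp
  rw [h6]
  congr 1
  rw [div_eq_iff h4, div_mul_eq_mul_div, div_mul_eq_mul_div, eq_div_iff h2, h5]
  ring

theorem wronskian_lemma {a b c : Polynomial ℂ} (ha : a ≠ 0) (hb : b ≠ 0)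
    (h : a * b.derivative - a.derivative * b + c * a * b = 0) : c = 0 := by
  by_contra hc
  have h1 : c * a * b = a.derivative * b - a * b.derivative := by linear_combination h
  have d1 : (a.derivative * b).degree < a.degree + b.degree := by
    rw [Polynomial.degree_mul]
    exact WithBot.add_lt_add_right (Polynomial.degree_ne_bot.2 hb) (Polynomial.degree_derivative_lt ha)
  have d2 : (a * b.derivative).degree < a.degree + b.degree := by
    rw [Polynomial.degree_mul]
    exact WithBot.add_lt_add_left (Polynomial.degree_ne_bot.2 ha) (Polynomial.degree_derivative_lt hb)
  have d3 := lt_of_le_of_lt (Polynomial.degree_sub_le (a.derivative * b) (a * b.derivative)) (max_lt d1 d2)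
  rw [← h1, mul_assoc, Polynomial.degree_mul, Polynomial.degree_mul] at d3
  have d4 : (0 : WithBot ℕ) ≤ c.degree := Polynomial.zero_le_degree_iff.2 hc
  have d5 := add_le_add_left d4 (a.degree + b.degree)
  rw [zero_add] at d5
  exact absurd d3 (not_lt.2 d5)

theorem borel_poly {ι : Type*} (s : Finset ι) : ∀ (R P : ι → Polynomial ℂ),
    (∀ i ∈ s, ∀ j ∈ s, i ≠ j → (P i).derivative ≠ (P j).derivative) →
    (∀ z : ℂ, ∑ i ∈ s, (R i).eval z * Complex.exp ((P i).eval z) = 0) → ∀ i ∈ s, R i = 0 := by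
  induction s using Finset.induction_on with
  | empty => intro R P _ _ i hi; simp at hi
  | insert i0 t hi0 ih =>
    intro R P hP hz
    have hPt : ∀ i ∈ t, ∀ j ∈ t, i ≠ j → (P i).derivative ≠ (P j).derivative := fun i hi j hj =>
      hP i (Finset.mem_insert_of_mem hi) j (Finset.mem_insert_of_mem hj)
    by_cases h0 : R i0 = 0
    · have := ih R P hPt (by
        intro z
        have := hz z
        rw [Finset.sum_insert hi0, h0] at this
        simpa using this)
      intro i hi
      rcases Finset.mem_insert.1 hi with rfl | h
      · exact h0
      · exact this i h
    · exfalso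
      have hder : ∀ z : ℂ, ∑ i ∈ insert i0 t,
          ((R i).derivative.eval z + (P i).derivative.eval z * (R i).eval z) * Complex.exp ((P i).eval z) = 0 := by
        intro z
        have h1 : HasDerivAt (fun z => ∑ i ∈ insert i0 t, (R i).eval z * Complex.exp ((P i).eval z))
            (∑ i ∈ insert i0 t, ((R i).derivative.eval z * Complex.exp ((P i).eval z) +
              (R i).eval z * (Complex.exp ((P i).eval z) * (P i).derivative.eval z))) z := by
          apply HasDerivAt.fun_sum
          intro i _
          exact ((R i).hasDerivAt z).mul ((P i).hasDerivAt z).cexp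
        have h2 : (fun z => ∑ i ∈ insert i0 t, (R i).eval z * Complex.exp ((P i).eval z)) = fun _ => 0 := by
          ext z; exact hz z
        rw [h2] at h1
        have h3 := h1.unique (hasDerivAt_const z (0:ℂ))
        rw [← h3]
        apply Finset.sum_congr rfl
        intros; ring
      have key := ih (fun i => R i0 * ((R i).derivative + (P i).derivative * R i) -
        ((R i0).derivative + (P i0).derivative * R i0) * R i) P hPt (by
          intro z
          have e1 := hz z
          have e2 := hder z
          rw [Finset.sum_insert hi0] at e1 e2
          have e3 : ∑ i ∈ t, (R i0 * ((R i).derivative + (P i).derivative * R i) -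
              ((R i0).derivative + (P i0).derivative * R i0) * R i).eval z * Complex.exp ((P i).eval z) =
              (R i0).eval z * (∑ i ∈ t, ((R i).derivative.eval z + (P i).derivative.eval z * (R i).eval z)
                * Complex.exp ((P i).eval z)) -
              ((R i0).derivative.eval z + (P i0).derivative.eval z * (R i0).eval z) *
                ∑ i ∈ t, (R i).eval z * Complex.exp ((P i).eval z) := by
            rw [Finset.mul_sum, Finset.mul_sum, ← Finset.sum_sub_distrib]
            apply Finset.sum_congr rfl
            intro i _
            simp only [Polynomial.eval_sub, Polynomial.eval_mul, Polynomial.eval_add]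
            ring
          rw [e3]
          linear_combination (R i0).eval z * e2 -
            ((R i0).derivative.eval z + (P i0).derivative.eval z * (R i0).eval z) * e1)
      have hRt : ∀ i ∈ t, R i = 0 := by
        intro i hi
        by_contra hRi
        have hk := key i hi
        have := wronskian_lemma (c := (P i).derivative - (P i0).derivative) h0 hRi (by linear_combination hk)
        exact hP i (Finset.mem_insert_of_mem hi) i0 (Finset.mem_insert_self _ _)
          (fun h => hi0 (h ▸ hi)) (sub_eq_zero.1 this)
      apply h0
      apply Polynomial.funext
      intro z
      have e1 := hz z
      rw [Finset.sum_insert hi0, Finset.sum_eq_zero (fun i hi => by rw [hRt i hi]; simp), add_zero] at e1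
      simpa [Complex.exp_ne_zero] using e1

theorem isRat_iff {r : ℂ → ℂ} : IsRatFn r ↔
    ∃ p q : Polynomial ℂ, q ≠ 0 ∧ r =ᶠ[cod] fun z => p.eval z / q.eval z := by
  simp only [IsRatFn, meroEq_iff]

theorem IsRatFn.congr {r t : ℂ → ℂ} (h : IsRatFn r) (e : t =ᶠ[cod] r) : IsRatFn t := by
  rw [isRat_iff] at h ⊢
  obtain ⟨p, q, hq, he⟩ := h
  exact ⟨p, q, hq, e.trans he⟩

theorem IsRatFn.poly (p : Polynomial ℂ) : IsRatFn (fun z => p.eval z) :=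
  isRat_iff.2 ⟨p, 1, one_ne_zero, by simp⟩

theorem IsRatFn.const (c : ℂ) : IsRatFn (fun _ => c) := by
  simpa using IsRatFn.poly (Polynomial.C c)

theorem IsRatFn.add {r t : ℂ → ℂ} (h : IsRatFn r) (h' : IsRatFn t) : IsRatFn (fun z => r z + t z) := by
  rw [isRat_iff] at h h' ⊢
  obtain ⟨p, q, hq, he⟩ := h
  obtain ⟨p', q', hq', he'⟩ := h'
  refine ⟨p * q' + p' * q, q * q', mul_ne_zero hq hq', ?_⟩
  filter_upwards [he, he', cod_poly_ne hq, cod_poly_ne hq'] with z h1 h2 h3 h4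
  rw [h1, h2]
  simp only [Polynomial.eval_add, Polynomial.eval_mul]
  field_simp

theorem IsRatFn.mul {r t : ℂ → ℂ} (h : IsRatFn r) (h' : IsRatFn t) : IsRatFn (fun z => r z * t z) := by
  rw [isRat_iff] at h h' ⊢
  obtain ⟨p, q, hq, he⟩ := h
  obtain ⟨p', q', hq', he'⟩ := h'
  refine ⟨p * p', q * q', mul_ne_zero hq hq', ?_⟩
  filter_upwards [he, he', cod_poly_ne hq, cod_poly_ne hq'] with z h1 h2 h3 h4
  rw [h1, h2]
  simp only [Polynomial.eval_mul]
  field_simp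

theorem IsRatFn.inv {r : ℂ → ℂ} (h : IsRatFn r) : IsRatFn (fun z => (r z)⁻¹) := by
  rw [isRat_iff] at h ⊢
  obtain ⟨p, q, hq, he⟩ := h
  by_cases hp : p = 0
  · refine ⟨0, 1, one_ne_zero, ?_⟩
    filter_upwards [he] with z h1
    rw [h1, hp]; simp
  · refine ⟨q, p, hp, ?_⟩
    filter_upwards [he] with z h1
    rw [h1, inv_div]

theorem IsRatFn.div {r t : ℂ → ℂ} (h : IsRatFn r) (h' : IsRatFn t) : IsRatFn (fun z => r z / t z) := by
  simpa [div_eq_mul_inv] using h.mul h'.inv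

theorem IsRatFn.neg {r : ℂ → ℂ} (h : IsRatFn r) : IsRatFn (fun z => - r z) := by
  simpa using (IsRatFn.const (-1)).mul h

theorem IsRatFn.sub {r t : ℂ → ℂ} (h : IsRatFn r) (h' : IsRatFn t) : IsRatFn (fun z => r z - t z) := by
  simpa [sub_eq_add_neg] using h.add h'.neg

theorem IsRatFn.deriv {r : ℂ → ℂ} (h : IsRatFn r) : IsRatFn (deriv r) := by
  rw [isRat_iff] at h ⊢
  obtain ⟨p, q, hq, he⟩ := h
  refine ⟨p.derivative * q - p * q.derivative, q ^ 2, pow_ne_zero _ hq, ?_⟩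
  refine (cod_deriv he).trans ?_
  filter_upwards [cod_poly_ne hq] with z hz
  have := ((p.hasDerivAt z).div (q.hasDerivAt z) hz).deriv
  simp only [Polynomial.eval_pow, Polynomial.eval_sub, Polynomial.eval_mul]
  exact this

theorem IsRatFn.dich {r : ℂ → ℂ} (h : IsRatFn r) : (∀ᶠ z in cod, r z = 0) ∨ ∀ᶠ z in cod, r z ≠ 0 := by
  rw [isRat_iff] at h
  obtain ⟨p, q, hq, he⟩ := h
  by_cases hp : p = 0
  · left
    filter_upwards [he] with z h1
    rw [h1, hp]; simp
  · right
    filter_upwards [he, cod_poly_ne hp, cod_poly_ne hq] with z h1 h2 h3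
    rw [h1]; exact div_ne_zero h2 h3

theorem IsRatFn.diff {r : ℂ → ℂ} (h : IsRatFn r) : ∀ᶠ z in cod, DifferentiableAt ℂ r z := by
  rw [isRat_iff] at h
  obtain ⟨p, q, hq, he⟩ := h
  filter_upwards [cod_nhds he, cod_poly_ne hq] with z h1 h2
  have h3 : r =ᶠ[𝓝 z] fun z => p.eval z / q.eval z := h1
  exact h3.differentiableAt_iff.2 (p.differentiableAt.div q.differentiableAt h2)

theorem borel_rat {ι : Type*} (s : Finset ι) (r : ι → ℂ → ℂ) (P : ι → Polynomial ℂ)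
    (hr : ∀ i, IsRatFn (r i))
    (hP : ∀ i ∈ s, ∀ j ∈ s, i ≠ j → (P i).derivative ≠ (P j).derivative)
    (hz : ∀ᶠ z in cod, ∑ i ∈ s, r i z * Complex.exp ((P i).eval z) = 0) :
    ∀ i ∈ s, ∀ᶠ z in cod, r i z = 0 := by
  choose p q hq he using fun i => isRat_iff.1 (hr i)
  have hqs : ∀ᶠ z in cod, ∀ i ∈ s, (q i).eval z ≠ 0 :=
    (Filter.eventually_all_finset s).2 fun i _ => cod_poly_ne (hq i)
  have hes : ∀ᶠ z in cod, ∀ i ∈ s, r i z = (p i).eval z / (q i).eval z :=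
    (Filter.eventually_all_finset s).2 fun i _ => he i
  have h0 : (fun z => ∑ i ∈ s, (p i * ∏ j ∈ s.erase i, q j).eval z * Complex.exp ((P i).eval z)) =ᶠ[cod]
      fun _ => (0:ℂ) := by
    filter_upwards [hz, hqs, hes] with z h1 h2 h3
    have : ∑ i ∈ s, (p i * ∏ j ∈ s.erase i, q j).eval z * Complex.exp ((P i).eval z) =
        (∏ j ∈ s, (q j).eval z) * ∑ i ∈ s, r i z * Complex.exp ((P i).eval z) := by
      rw [Finset.mul_sum]
      apply Finset.sum_congr rfl
      intro i hi
      rw [h3 i hi, ← Finset.mul_prod_erase s _ hi, Polynomial.eval_mul, Polynomial.eval_prod]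
      have := h2 i hi
      field_simp
    rw [this, h1, mul_zero]
  have hall := cod_eq (by
    apply continuous_finsetSum
    intro i _
    exact (Polynomial.continuous _).mul (Complex.continuous_exp.comp (Polynomial.continuous _))) continuous_const h0
  have hb := borel_poly s (fun i => p i * ∏ j ∈ s.erase i, q j) P hP (fun z => congrFun hall z)
  intro i hi
  have hpi : p i = 0 := by
    rcases mul_eq_zero.1 (hb i hi) with h | h
    · exact h
    · exact absurd h (Finset.prod_ne_zero_iff.2 fun j _ => hq j)
  filter_upwards [he i] with z h1
  rw [h1, hpi]; simp

theorem mero_dich {φ : ℂ → ℂ} (h : ∀ z, MeromorphicAt φ z) :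
    (∀ᶠ z in cod, φ z = 0) ∨ ∀ᶠ z in cod, φ z ≠ 0 := by
  by_cases hz : ∃ z0, meromorphicOrderAt φ z0 = ⊤
  · left
    have hm : MeromorphicOn φ Set.univ := fun z _ => h z
    rw [ev_cod_iff]
    intro z
    rw [← meromorphicOrderAt_eq_top_iff]
    by_contra hne
    have := (hm.exists_meromorphicOrderAt_ne_top_iff_forall isConnected_univ).1 ⟨⟨z, trivial⟩, hne⟩
    obtain ⟨z0, hz0⟩ := hz
    exact this ⟨z0, trivial⟩ hz0
  · right
    push Not at hz
    rw [ev_cod_iff]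
    intro z
    exact (meromorphicOrderAt_ne_top_iff_eventually_ne_zero (h z)).1 (hz z)

theorem mero_const {h : ℂ → ℂ} (hm : ∀ z, MeromorphicAt h z) (hd : ∀ᶠ z in cod, HasDerivAt h 0 z) :
    ∃ c, ∀ᶠ z in cod, h z = c := by
  obtain ⟨z0, hz0⟩ := (cod_nhds hd).exists
  obtain ⟨ε, hε, hb⟩ := Metric.eventually_nhds_iff_ball.1 hz0
  refine ⟨h z0, ?_⟩
  have hcst : ∀ w ∈ Metric.ball z0 ε, h w = h z0 := by
    intro w hw
    exact IsOpen.is_const_of_deriv_eq_zero Metric.isOpen_ball (convex_ball z0 ε).isPreconnected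
      (fun x hx => (hb x hx).differentiableAt.differentiableWithinAt)
      (fun x hx => (hb x hx).deriv) hw (Metric.mem_ball_self hε)
  rcases mero_dich (φ := fun z => h z - h z0) (fun z => (hm z).sub (MeromorphicAt.const _ _)) with h1 | h1
  · filter_upwards [h1] with z hz
    exact sub_eq_zero.1 hz
  · exfalso
    have h2 : ∀ᶠ w in 𝓝[≠] z0, h w = h z0 :=
      nhdsWithin_le_nhds (by filter_upwards [Metric.ball_mem_nhds z0 hε] with w hw using hcst w hw)
    obtain ⟨w, h3, h4⟩ := ((ev_cod_iff.1 h1 z0).and h2).exists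
    exact h3 (by rw [h4]; simp)

theorem hit_lattice (h : ℂ → ℂ) (ρ₀ : ℝ) (hd : ∀ z : ℂ, ρ₀ < ‖z‖ → DifferentiableAt ℂ h z)
    (lam : ℝ) (hlam : lam ≠ 0) (d : ℕ) (hd2 : 2 ≤ d)
    (hlim : Tendsto (fun z => h z / z ^ d) (Bornology.cobounded ℂ) (𝓝 (I * lam))) :
    ∀ ρ : ℝ, ∃ z : ℂ, ρ < ‖z‖ ∧ z.im ≠ 0 ∧ ∃ k : ℤ, h z = k * (2 * Real.pi * I) := by
  intro ρ
  have hd0 : (d : ℝ) ≠ 0 := by positivity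
  have hdR : (2 : ℝ) ≤ d := by exact_mod_cast hd2
  set l : ℂ := I * lam with hl
  have hl0 : l ≠ 0 := by simp [hl, hlam]
  have hln : 0 < ‖l‖ := norm_pos_iff.mpr hl0
  have hlnorm : ‖l‖ = |lam| := by simp [hl]
  set ζ₀ : ℂ := exp ((Real.pi / d : ℝ) * I) with hζ
  have hζn : ‖ζ₀‖ = 1 := by rw [hζ, Complex.norm_exp_ofReal_mul_I]
  have hζd : ζ₀ ^ d = -1 := by
    rw [hζ, ← Complex.exp_nat_mul]
    have : (d : ℂ) * (((Real.pi / d : ℝ) : ℂ) * I) = Real.pi * I := by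
      have : (d : ℂ) ≠ 0 := by exact_mod_cast hd0
      push_cast
      field_simp
    rw [this, Complex.exp_pi_mul_I]
  have hζim : 0 < ζ₀.im := by
    rw [hζ, Complex.exp_ofReal_mul_I_im]
    apply Real.sin_pos_of_pos_of_lt_pi
    · positivity
    · exact div_lt_self Real.pi_pos (by linarith)
  -- choose δ
  obtain ⟨δ, hδ0, hδ1, hδ2, hδ3⟩ : ∃ δ > 0, δ ≤ 1 / 4 ∧ δ < ζ₀.im ∧
      ∀ ζ ∈ Metric.sphere ζ₀ δ, ζ ^ d ≠ ζ₀ ^ d := by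
    have han : AnalyticAt ℂ (fun ζ : ℂ => ζ ^ d) ζ₀ := by fun_prop
    have hne : ∀ᶠ ζ in 𝓝[≠] ζ₀, ζ ^ d ≠ ζ₀ ^ d := by
      rcases han.eventually_eq_or_eventually_ne (analyticAt_const (v := ζ₀ ^ d)) with h1 | h1
      · exfalso
        have h2 : (fun ζ : ℂ => ζ ^ d) =ᶠ[𝓝 ζ₀] fun _ => ζ₀ ^ d := h1
        have h3 := h2.deriv_eq
        simp only [deriv_const, deriv_pow_field] at h3
        have hz : ζ₀ ≠ 0 := by rw [← norm_pos_iff, hζn]; norm_num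
        have : (d : ℂ) ≠ 0 := by exact_mod_cast hd0
        exact mul_ne_zero this (pow_ne_zero _ hz) h3
      · exact h1
    rw [eventually_nhdsWithin_iff, Metric.eventually_nhds_iff] at hne
    obtain ⟨ε, hε, hε2⟩ := hne
    refine ⟨min (1/4) (min (ζ₀.im / 2) (ε / 2)), by positivity, min_le_left _ _, ?_, ?_⟩
    · calc _ ≤ ζ₀.im / 2 := (min_le_right _ _).trans (min_le_left _ _)
        _ < _ := by linarith
    · intro ζ hζs
      rw [Metric.mem_sphere] at hζs
      have hp : (0:ℝ) < min (1/4) (min (ζ₀.im / 2) (ε / 2)) := by positivity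
      apply hε2
      · rw [hζs]
        calc _ ≤ ε / 2 := (min_le_right _ _).trans (min_le_right _ _)
          _ < _ := by linarith
      · intro h0
        rw [Set.mem_singleton_iff.mp h0, dist_self] at hζs
        linarith
  obtain ⟨m, hm0, hm⟩ : ∃ m > 0, ∀ ζ ∈ Metric.sphere ζ₀ δ, m ≤ ‖ζ ^ d - ζ₀ ^ d‖ := by
    have hc : IsCompact (Metric.sphere ζ₀ δ) := isCompact_sphere _ _
    have hne : (Metric.sphere ζ₀ δ).Nonempty := NormedSpace.sphere_nonempty.mpr hδ0.le
    obtain ⟨x, hx, hx2⟩ := hc.exists_isMinOn hne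
      (f := fun ζ => ‖ζ ^ d - ζ₀ ^ d‖) (by fun_prop)
    exact ⟨_, norm_pos_iff.mpr (sub_ne_zero.mpr (hδ3 x hx)), fun ζ hζ => hx2 hζ⟩
  set η : ℝ := ‖l‖ * m / 8 with hη
  have hη0 : 0 < η := by positivity
  obtain ⟨ρ₁, hρ₁⟩ : ∃ ρ₁ : ℝ, ∀ z : ℂ, ρ₁ < ‖z‖ → ‖h z / z ^ d - l‖ ≤ η / 2 ^ d := by
    have h1 : ∀ᶠ z in Bornology.cobounded ℂ, ‖h z / z ^ d - l‖ < η / 2 ^ d := by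
      have := hlim.eventually (Metric.ball_mem_nhds l (by positivity : 0 < η / 2 ^ d))
      filter_upwards [this] with z hz
      rwa [← dist_eq_norm]
    rw [(Filter.hasBasis_cobounded_norm (E := ℂ)).eventually_iff] at h1
    obtain ⟨R, -, hR⟩ := h1
    exact ⟨R, fun z hz => (hR (show R ≤ ‖z‖ from hz.le)).le⟩
  set R := max (max ρ₀ ρ₁) (max ρ 1) with hR
  obtain ⟨n, hn⟩ := exists_nat_gt (|lam| * (2 * R) ^ d / (2 * Real.pi))
  have hR1 : 1 ≤ R := (le_max_right _ _).trans (le_max_right _ _)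
  have hla : 0 < |lam| := abs_pos.mpr hlam
  obtain ⟨r, hr0, hrd, hrR⟩ : ∃ r : ℝ, 0 < r ∧ r ^ d = 2 * Real.pi * n / |lam| ∧ 2 * R < r := by
    have hx : (2 * R) ^ d < 2 * Real.pi * n / |lam| := by
      rw [lt_div_iff₀ hla]
      rw [div_lt_iff₀ (by positivity)] at hn
      linarith
    have hx0 : 0 < 2 * Real.pi * n / |lam| := lt_of_le_of_lt (by positivity) hx
    have e : ((2 * Real.pi * n / |lam|) ^ ((d : ℝ)⁻¹)) ^ d = 2 * Real.pi * n / |lam| :=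
      Real.rpow_inv_natCast_pow hx0.le (by omega)
    refine ⟨_, Real.rpow_pos_of_pos hx0 _, e, ?_⟩
    rw [← e] at hx
    exact lt_of_pow_lt_pow_left₀ d (Real.rpow_nonneg hx0.le _) hx
  have hrC : (r : ℂ) ≠ 0 := by exact_mod_cast hr0.ne'
  set F : ℂ → ℂ := fun ζ => h (r * ζ) / r ^ d with hF
  have hbig : ∀ ζ ∈ Metric.ball ζ₀ (2 * δ), R < ‖(r : ℂ) * ζ‖ := by
    intro ζ hζ
    rw [Metric.mem_ball, dist_eq_norm] at hζ
    have h1 : 1 ≤ ‖ζ‖ + ‖ζ - ζ₀‖ := by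
      rw [← hζn]
      calc ‖ζ₀‖ = ‖ζ - (ζ - ζ₀)‖ := by congr 1; ring
        _ ≤ _ := norm_sub_le _ _
    rw [norm_mul, Complex.norm_real, Real.norm_eq_abs, abs_of_pos hr0]
    have h2 : 1 / 2 ≤ ‖ζ‖ := by linarith
    nlinarith
  have hsub : Metric.closedBall ζ₀ δ ⊆ Metric.ball ζ₀ (2 * δ) :=
    Metric.closedBall_subset_ball (by linarith)
  have hFd : DifferentiableOn ℂ F (Metric.ball ζ₀ (2 * δ)) := by
    intro ζ hζ
    have h1 : DifferentiableAt ℂ h (r * ζ) :=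
      hd _ (lt_of_le_of_lt ((le_max_left _ _).trans (le_max_left _ _)) (hbig ζ hζ))
    have h2 : DifferentiableAt ℂ (fun ζ : ℂ => h (r * ζ)) ζ :=
      DifferentiableAt.fun_comp' ζ (g := h) h1 (by fun_prop)
    exact (h2.div_const _).differentiableWithinAt
  have hFe : ∀ ζ ∈ Metric.closedBall ζ₀ δ, ‖F ζ - l * ζ ^ d‖ ≤ η := by
    intro ζ hζ
    have hb := hbig ζ (hsub hζ)
    have hz0 : ζ ≠ 0 := by
      rintro rfl
      simp at hb
      linarith
    have e : F ζ - l * ζ ^ d = ζ ^ d * (h (r * ζ) / (r * ζ) ^ d - l) := by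
      simp only [hF, mul_pow]
      field_simp
    have h1 := hρ₁ (r * ζ) (lt_of_le_of_lt ((le_max_right _ _).trans (le_max_left _ _)) hb)
    have h2 : ‖ζ‖ ≤ 2 := by
      rw [Metric.mem_closedBall, dist_eq_norm] at hζ
      calc ‖ζ‖ = ‖(ζ - ζ₀) + ζ₀‖ := by congr 1; ring
        _ ≤ _ := norm_add_le _ _
        _ ≤ 2 := by linarith
    rw [e, norm_mul, norm_pow]
    calc _ ≤ 2 ^ d * (η / 2 ^ d) := by gcongr
      _ = η := by field_simp
  have hc0 : ζ₀ ∈ Metric.closedBall ζ₀ δ := Metric.mem_closedBall_self hδ0.le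
  have hsph : ∀ ζ ∈ Metric.sphere ζ₀ δ, 6 * η ≤ ‖F ζ - F ζ₀‖ := by
    intro ζ hζ
    have h1 := hFe ζ (Metric.sphere_subset_closedBall hζ)
    have h2 := hFe ζ₀ hc0
    have h3 := hm ζ hζ
    have h4 : ‖l * ζ ^ d - l * ζ₀ ^ d‖ = ‖l‖ * ‖ζ ^ d - ζ₀ ^ d‖ := by
      rw [← mul_sub, norm_mul]
    have h5 : ‖l * ζ ^ d - l * ζ₀ ^ d‖ ≤ ‖F ζ - l * ζ ^ d‖ + ‖F ζ - F ζ₀‖ + ‖F ζ₀ - l * ζ₀ ^ d‖ := by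
      calc _ = ‖-(F ζ - l * ζ ^ d) + (F ζ - F ζ₀) + (F ζ₀ - l * ζ₀ ^ d)‖ := by congr 1; ring
        _ ≤ _ := norm_add₃_le
        _ = _ := by rw [norm_neg]
    have h6 : ‖l‖ * m ≤ ‖l‖ * ‖ζ ^ d - ζ₀ ^ d‖ := by gcongr
    rw [hη] at *
    linarith
  have hfreq : ∃ᶠ z in 𝓝 ζ₀, F z ≠ F ζ₀ := by
    intro hcon
    have hcon' : F =ᶠ[𝓝 ζ₀] fun _ => F ζ₀ := by
      filter_upwards [hcon] with z hz
      simpa using hz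
    have han : AnalyticOnNhd ℂ F (Metric.ball ζ₀ (2 * δ)) := hFd.analyticOnNhd Metric.isOpen_ball
    have := han.eqOn_of_preconnected_of_eventuallyEq (g := fun _ => F ζ₀) analyticOnNhd_const
      (convex_ball ζ₀ (2 * δ)).isPreconnected (Metric.mem_ball_self (by linarith)) hcon'
    obtain ⟨x, hx⟩ : (Metric.sphere ζ₀ δ).Nonempty := NormedSpace.sphere_nonempty.mpr hδ0.le
    have h1 := hsph x hx
    rw [this (hsub (Metric.sphere_subset_closedBall hx))] at h1
    simp at h1
    linarith
  have hdc : DiffContOnCl ℂ F (Metric.ball ζ₀ δ) :=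
    DifferentiableOn.diffContOnCl (hFd.mono (by
      rw [closure_ball _ hδ0.ne']; exact hsub))
  have himg := hdc.ball_subset_image_closedBall hδ0 hsph hfreq
  have htar : l * ζ₀ ^ d ∈ Metric.ball (F ζ₀) (6 * η / 2) := by
    rw [Metric.mem_ball, dist_comm, dist_eq_norm]
    have := hFe ζ₀ hc0
    linarith
  obtain ⟨ζ, hζm, hζe⟩ := himg htar
  refine ⟨r * ζ, lt_of_le_of_lt ((le_max_left _ _).trans (le_max_right _ _)) (hbig ζ (hsub hζm)),
    ?_, ?_⟩
  · have h1 : |(ζ - ζ₀).im| ≤ δ := by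
      refine (Complex.abs_im_le_norm _).trans ?_
      rw [← dist_eq_norm]; exact hζm
    have h2 : 0 < ζ.im := by
      rw [Complex.sub_im] at h1
      have := (abs_le.mp h1).1
      linarith
    rw [Complex.im_ofReal_mul]
    positivity
  · have e : h (r * ζ) = r ^ d * (l * ζ₀ ^ d) := by
      rw [← hζe]
      simp only [hF]
      field_simp
    have e2 : (r : ℂ) ^ d = 2 * Real.pi * n / ((|lam| : ℝ) : ℂ) := by
      rw [← Complex.ofReal_pow, hrd]; push_cast; rfl
    have hlC : (lam : ℂ) ≠ 0 := by exact_mod_cast hlam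
    rcases abs_choice lam with ha | ha
    · refine ⟨-(n : ℤ), ?_⟩
      rw [e, e2, hζd, ha, hl]
      push_cast
      field_simp
    · refine ⟨n, ?_⟩
      rw [e, e2, hζd, ha, hl]
      push_cast
      field_simp

theorem poly_lim (p : Polynomial ℂ) :
    Tendsto (fun z => p.eval z / z ^ p.natDegree) (Bornology.cobounded ℂ) (𝓝 p.leadingCoeff) := by
  have h1 : Tendsto (fun z : ℂ => p.reverse.eval z⁻¹) (Bornology.cobounded ℂ) (𝓝 (p.reverse.eval 0)) :=
    (p.reverse.continuous.tendsto 0).comp tendsto_inv₀_cobounded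
  rw [← Polynomial.coeff_zero_eq_eval_zero, Polynomial.coeff_zero_reverse] at h1
  refine h1.congr' ?_
  filter_upwards [Bornology.eventually_ne_cobounded (0:ℂ)] with z hz
  let _ := invertibleOfNonzero hz
  have := Polynomial.eval₂_reverse_mul_pow (RingHom.id ℂ) z p
  rw [invOf_eq_inv] at this
  rw [eq_div_iff (pow_ne_zero _ hz)]
  exact this

theorem hit_one (a b p : Polynomial ℂ) (ha : a ≠ 0) (hb : b ≠ 0) (hab : a.natDegree = b.natDegree)
    (hp : 2 ≤ p.natDegree) (lam : ℝ) (hlam : p.leadingCoeff = I * lam) (ρ : ℝ) :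
    ∃ z : ℂ, ρ < ‖z‖ ∧ z.im ≠ 0 ∧ b.eval z ≠ 0 ∧ a.eval z / b.eval z * exp (p.eval z) = 1 := by
  have hlam0 : lam ≠ 0 := by
    rintro rfl
    have : p = 0 := by simpa using hlam
    rw [this] at hp
    simp at hp
  set c : ℂ := a.leadingCoeff / b.leadingCoeff with hc
  have hla : a.leadingCoeff ≠ 0 := by simpa using ha
  have hlb : b.leadingCoeff ≠ 0 := by simpa using hb
  have hc0 : c ≠ 0 := div_ne_zero hla hlb
  set w : ℂ → ℂ := fun z => a.eval z / b.eval z / c with hw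
  have hwl : Tendsto w (Bornology.cobounded ℂ) (𝓝 1) := by
    have h1 := ((poly_lim a).div (poly_lim b) hlb).div_const c
    rw [← hc, div_self hc0] at h1
    refine h1.congr' ?_
    filter_upwards [Bornology.eventually_ne_cobounded (0:ℂ)] with z hz
    simp only [hw, Pi.div_apply, hab]
    congr 1
    exact div_div_div_cancel_right₀ (pow_ne_zero _ hz) _ _
  have hslit : ∀ᶠ z in Bornology.cobounded ℂ, w z ∈ slitPlane :=
    hwl.eventually (Complex.isOpen_slitPlane.mem_nhds Complex.one_mem_slitPlane)
  rw [(Filter.hasBasis_cobounded_norm (E := ℂ)).eventually_iff] at hslit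
  obtain ⟨ρ₀, -, hρ₀⟩ := hslit
  have hs : ∀ z : ℂ, ρ₀ < ‖z‖ → w z ∈ slitPlane := fun z hz => hρ₀ (show ρ₀ ≤ ‖z‖ from hz.le)
  have hbz : ∀ z : ℂ, ρ₀ < ‖z‖ → b.eval z ≠ 0 := by
    intro z hz h0
    have := Complex.slitPlane_ne_zero (hs z hz)
    simp [hw, h0] at this
  have hlog : Tendsto (fun z => Complex.log (w z)) (Bornology.cobounded ℂ) (𝓝 0) := by
    have := ((continuousAt_clog Complex.one_mem_slitPlane).tendsto).comp hwl
    simpa [Function.comp_def] using this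
  have hinv : Tendsto (fun z : ℂ => (z ^ p.natDegree)⁻¹) (Bornology.cobounded ℂ) (𝓝 0) := by
    have h1 : Tendsto (fun z : ℂ => (z⁻¹) ^ p.natDegree) (Bornology.cobounded ℂ) (𝓝 (0 ^ p.natDegree)) :=
      tendsto_inv₀_cobounded.pow _
    rw [zero_pow (by omega)] at h1
    simpa using h1
  obtain ⟨z, hz1, hz2, k, hk⟩ := hit_lattice (fun z => p.eval z + Complex.log c + Complex.log (w z)) ρ₀
    (by
      intro z hz
      have h1 : DifferentiableAt ℂ w z := by
        have := hbz z hz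
        have h2 : DifferentiableAt ℂ (fun z => a.eval z / b.eval z) z :=
          DifferentiableAt.fun_div (a.differentiable z) (b.differentiable z) this
        exact h2.div_const c
      exact ((p.differentiable z).add_const _).add (h1.clog (hs z hz)))
    lam hlam0 p.natDegree hp
    (by
      have h1 := ((poly_lim p).add (hinv.const_mul (Complex.log c))).add (hlog.mul hinv)
      rw [mul_zero, mul_zero, add_zero, add_zero, hlam] at h1
      refine h1.congr ?_
      intro z
      simp only [div_eq_mul_inv]
      ring) (max ρ ρ₀)
  refine ⟨z, (le_max_left _ _).trans_lt hz1, hz2, hbz z ((le_max_right _ _).trans_lt hz1), ?_⟩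
  have hz3 := hs z ((le_max_right _ _).trans_lt hz1)
  have h1 : exp (p.eval z + Complex.log c + Complex.log (w z)) = 1 := by
    rw [show p.eval z + Complex.log c + Complex.log (w z) = k * (2 * Real.pi * I) from hk]
    exact Complex.exp_int_mul_two_pi_mul_I k
  rw [Complex.exp_add, Complex.exp_add, Complex.exp_log hc0,
    Complex.exp_log (Complex.slitPlane_ne_zero hz3)] at h1
  rw [← h1]
  simp only [hw]
  field_simp

theorem borel2 {r₁ r₂ : ℂ → ℂ} {P₁ P₂ : Polynomial ℂ} (h₁ : IsRatFn r₁) (h₂ : IsRatFn r₂)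
    (h12 : P₁.derivative ≠ P₂.derivative)
    (hz : ∀ᶠ z in cod, r₁ z * exp (P₁.eval z) + r₂ z * exp (P₂.eval z) = 0) :
    (∀ᶠ z in cod, r₁ z = 0) ∧ (∀ᶠ z in cod, r₂ z = 0) := by
  have := borel_rat (Finset.univ : Finset (Fin 2)) ![r₁, r₂] ![P₁, P₂]
    (by intro i; fin_cases i <;> simpa)
    (by
      intro i _ j _ hij
      fin_cases i <;> fin_cases j <;> simp_all [eq_comm])
    (by simpa [Fin.sum_univ_succ] using hz)
  exact ⟨by simpa using this 0, by simpa using this 1⟩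

theorem borel3 {r₁ r₂ r₃ : ℂ → ℂ} {P₁ P₂ P₃ : Polynomial ℂ} (h₁ : IsRatFn r₁) (h₂ : IsRatFn r₂)
    (h₃ : IsRatFn r₃)
    (h12 : P₁.derivative ≠ P₂.derivative) (h13 : P₁.derivative ≠ P₃.derivative)
    (h23 : P₂.derivative ≠ P₃.derivative)
    (hz : ∀ᶠ z in cod, r₁ z * exp (P₁.eval z) + r₂ z * exp (P₂.eval z) + r₃ z * exp (P₃.eval z) = 0) :
    (∀ᶠ z in cod, r₁ z = 0) ∧ (∀ᶠ z in cod, r₂ z = 0) ∧ (∀ᶠ z in cod, r₃ z = 0) := by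
  have := borel_rat (Finset.univ : Finset (Fin 3)) ![r₁, r₂, r₃] ![P₁, P₂, P₃]
    (by intro i; fin_cases i <;> simpa)
    (by
      intro i _ j _ hij
      fin_cases i <;> fin_cases j <;> simp_all [eq_comm])
    (by simpa [Fin.sum_univ_succ, add_assoc] using hz)
  exact ⟨by simpa using this 0, by simpa using this 1, by simpa using this 2⟩

theorem borel4 {r₁ r₂ r₃ r₄ : ℂ → ℂ} {P₁ P₂ P₃ P₄ : Polynomial ℂ} (h₁ : IsRatFn r₁)
    (h₂ : IsRatFn r₂) (h₃ : IsRatFn r₃) (h₄ : IsRatFn r₄)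
    (h12 : P₁.derivative ≠ P₂.derivative) (h13 : P₁.derivative ≠ P₃.derivative)
    (h14 : P₁.derivative ≠ P₄.derivative)
    (h23 : P₂.derivative ≠ P₃.derivative) (h24 : P₂.derivative ≠ P₄.derivative)
    (h34 : P₃.derivative ≠ P₄.derivative)
    (hz : ∀ᶠ z in cod, r₁ z * exp (P₁.eval z) + r₂ z * exp (P₂.eval z) + r₃ z * exp (P₃.eval z)
      + r₄ z * exp (P₄.eval z) = 0) :
    (∀ᶠ z in cod, r₁ z = 0) ∧ (∀ᶠ z in cod, r₂ z = 0) ∧ (∀ᶠ z in cod, r₃ z = 0) ∧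
      (∀ᶠ z in cod, r₄ z = 0) := by
  have := borel_rat (Finset.univ : Finset (Fin 4)) ![r₁, r₂, r₃, r₄] ![P₁, P₂, P₃, P₄]
    (by intro i; fin_cases i <;> simpa)
    (by
      intro i _ j _ hij
      fin_cases i <;> fin_cases j <;> simp_all [eq_comm])
    (by simpa [Fin.sum_univ_succ, add_assoc] using hz)
  exact ⟨by simpa using this 0, by simpa using this 1, by simpa using this 2, by simpa using this 3⟩

theorem exp_ratio {p q : Polynomial ℂ} (h : p.derivative = q.derivative) :
    ∃ κ : ℂ, κ ≠ 0 ∧ ∀ z, exp (p.eval z) = κ * exp (q.eval z) := by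
  have h0 : (p - q).derivative = 0 := by rw [Polynomial.derivative_sub, h, sub_self]
  rw [Polynomial.derivative_eq_zero] at h0
  refine ⟨exp ((p - q).coeff 0), exp_ne_zero _, fun z => ?_⟩
  rw [← Complex.exp_add]
  congr 1
  have : (p - q).eval z = (p - q).coeff 0 := by
    conv_lhs => rw [Polynomial.eq_C_of_natDegree_eq_zero h0]
    simp
  rw [← this, Polynomial.eval_sub]; ring

theorem exp_konst {p : Polynomial ℂ} (h : p.derivative = 0) :
    ∃ κ : ℂ, κ ≠ 0 ∧ ∀ z, exp (p.eval z) = κ := by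
  obtain ⟨κ, h1, h2⟩ := exp_ratio (p := p) (q := 0) (by simpa using h)
  exact ⟨κ, h1, fun z => by simpa using h2 z⟩

/-- Function of the form rational times exponential of a polynomial. -/
noncomputable def SE (a b P : Polynomial ℂ) : ℂ → ℂ := fun z => a.eval z / b.eval z * exp (P.eval z)

/-- Logarithmic derivative of `SE`. -/
noncomputable def sE (a b P : Polynomial ℂ) : ℂ → ℂ := fun z =>
  a.derivative.eval z / a.eval z - b.derivative.eval z / b.eval z + P.derivative.eval z

theorem sE_rat (a b P : Polynomial ℂ) : IsRatFn (sE a b P) :=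
  (((IsRatFn.poly _).div (IsRatFn.poly _)).sub ((IsRatFn.poly _).div (IsRatFn.poly _))).add
    (IsRatFn.poly _)

theorem SE_ne {a b : Polynomial ℂ} (P : Polynomial ℂ) (ha : a ≠ 0) (hb : b ≠ 0) :
    ∀ᶠ z in cod, SE a b P z ≠ 0 := by
  filter_upwards [cod_poly_ne ha, cod_poly_ne hb] with z h1 h2
  exact mul_ne_zero (div_ne_zero h1 h2) (exp_ne_zero _)

theorem SE_mero (a b P : Polynomial ℂ) (z : ℂ) : MeromorphicAt (SE a b P) z := by
  have h : ∀ p : Polynomial ℂ, AnalyticAt ℂ (fun z => p.eval z) z := fun p => by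
    exact Differentiable.analyticAt p.differentiable z
  exact ((h a).meromorphicAt.div (h b).meromorphicAt).mul ((h P).cexp).meromorphicAt

theorem SE_deriv {a b : Polynomial ℂ} (P : Polynomial ℂ) (ha : a ≠ 0) (hb : b ≠ 0) :
    ∀ᶠ z in cod, HasDerivAt (SE a b P) (sE a b P z * SE a b P z) z := by
  filter_upwards [cod_poly_ne ha, cod_poly_ne hb] with z h1 h2
  have h3 : HasDerivAt (SE a b P) _ z :=
    ((a.hasDerivAt z).fun_div (b.hasDerivAt z) h2).fun_mul (P.hasDerivAt z).cexp
  refine h3.congr_deriv ?_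
  simp only [sE, SE]
  field_simp

theorem sE_zero {a b P : Polynomial ℂ} (ha : a ≠ 0) (hb : b ≠ 0) (h : ∀ᶠ z in cod, sE a b P z = 0) :
    P.derivative = 0 ∧ ∃ c, ∀ᶠ z in cod, SE a b P z = c := by
  constructor
  · have key : (fun z => (b * a.derivative - b.derivative * a + P.derivative * b * a).eval z) =
        fun _ => (0:ℂ) := by
      refine cod_eq (Polynomial.continuous _) continuous_const ?_
      filter_upwards [cod_poly_ne ha, cod_poly_ne hb, h] with z h1 h2 h3
      simp only [sE] at h3
      field_simp at h3
      simp only [Polynomial.eval_add, Polynomial.eval_sub, Polynomial.eval_mul]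
      linear_combination h3
    have key2 : b * a.derivative - b.derivative * a + P.derivative * b * a = 0 := by
      apply Polynomial.funext
      intro z
      simpa using congrFun key z
    exact wronskian_lemma hb ha key2
  · apply mero_const (SE_mero a b P)
    filter_upwards [h, SE_deriv P ha hb] with z h1 h2
    simpa [h1] using h2

theorem SE_mtilde (a b P : Polynomial ℂ) : mtilde (SE a b P) = SE (ptilde a) (ptilde b) (ptilde P) := by
  funext z
  simp only [mtilde, SE, ptilde_eval, map_mul, map_div₀, ← Complex.exp_conj]

theorem mero_diff {f : ℂ → ℂ} (h : ∀ z, MeromorphicAt f z) : ∀ᶠ z in cod, DifferentiableAt ℂ f z := by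
  rw [ev_cod_iff]
  intro z
  filter_upwards [(h z).eventually_analyticAt] with w hw
  exact hw.differentiableAt

theorem rel_step {φ γ E : ℂ → ℂ} {a b P : Polynomial ℂ} (ha : a ≠ 0) (hb : b ≠ 0)
    (h0 : φ =ᶠ[cod] fun z => SE a b P z * γ z)
    (h1 : deriv φ =ᶠ[cod] fun z => E z * SE a b P z * deriv γ z)
    (hγ : ∀ z, MeromorphicAt γ z) :
    ∀ᶠ z in cod, sE a b P z * γ z = (E z - 1) * deriv γ z := by
  filter_upwards [cod_deriv h0, h1, mero_diff hγ, SE_deriv P ha hb, SE_ne P ha hb] with z e0 e1 d hS hS0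
  have := (hS.fun_mul d.hasDerivAt).deriv
  rw [e0, this] at e1
  apply mul_left_cancel₀ hS0
  linear_combination e1

theorem EB_exp (P : Polynomial ℂ) : EB (fun z => exp (P.eval z)) := by
  have key : ∃ (C : ℝ) (N : ℕ), 0 ≤ C ∧ ∀ M ≥ N, ∀ z : ℂ, ‖P.eval z‖ ≤ C * (1 + ‖z‖) ^ M := by
    induction P using Polynomial.induction_on' with
    | add p q hp hq =>
      obtain ⟨C, N, hC, h⟩ := hp
      obtain ⟨C', N', hC', h'⟩ := hq
      refine ⟨C + C', max N N', by positivity, fun M hM z => ?_⟩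
      have h1 := h M (le_of_max_le_left hM) z
      have h2 := h' M (le_of_max_le_right hM) z
      rw [Polynomial.eval_add]
      refine (norm_add_le _ _).trans ?_
      linarith
    | monomial n a =>
      refine ⟨‖a‖, n, norm_nonneg _, fun M hM z => ?_⟩
      rw [Polynomial.eval_monomial, norm_mul, norm_pow]
      gcongr
      calc ‖z‖ ^ n ≤ (1 + ‖z‖) ^ n := by gcongr; linarith [norm_nonneg z]
        _ ≤ _ := pow_le_pow_right₀ (by linarith [norm_nonneg z]) hM
  obtain ⟨C, N, hC, h⟩ := key
  refine ⟨fun z => (P.differentiable z).cexp, C, N, hC, fun z => ?_⟩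
  rw [Complex.norm_exp]
  exact Real.exp_le_exp.2 ((Complex.re_le_norm _).trans (h N le_rfl z))

theorem SE_ratio {a b a' b' : Polynomial ℂ} (P P' : Polynomial ℂ) (ha : a ≠ 0) (hb : b ≠ 0) :
    ∀ᶠ z in cod, SE a' b' P' z = SE (a' * b) (b' * a) (P' - P) z * SE a b P z := by
  filter_upwards [cod_poly_ne ha, cod_poly_ne hb] with z h1 h2
  simp only [SE, Polynomial.eval_mul, Polynomial.eval_sub, Complex.exp_sub]
  have := exp_ne_zero (P.eval z)
  by_cases h3 : b'.eval z = 0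
  · simp [h3]
  · field_simp

theorem sE_ratio {a b a' b' : Polynomial ℂ} (P P' : Polynomial ℂ) (ha : a ≠ 0) (hb : b ≠ 0)
    (ha' : a' ≠ 0) (hb' : b' ≠ 0) :
    ∀ᶠ z in cod, sE (a' * b) (b' * a) (P' - P) z = sE a' b' P' z - sE a b P z := by
  filter_upwards [cod_poly_ne ha, cod_poly_ne hb, cod_poly_ne ha', cod_poly_ne hb'] with z h1 h2 h3 h4
  simp only [sE, Polynomial.eval_mul, Polynomial.derivative_mul, Polynomial.eval_add,
    Polynomial.derivative_sub, Polynomial.eval_sub]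
  field_simp
  ring

/-- The degenerate case `s₁ = 0`. -/
theorem case_s1 {f g : ℂ → ℂ} {a b P : Polynomial ℂ} {c : ℂ} (ha : a ≠ 0) (hb : b ≠ 0)
    (hP : P.derivative ≠ 0) (hc : c ≠ 0) (hf : ∀ z, MeromorphicAt f z)
    (hg : ∀ z, MeromorphicAt g z) (hN : Nice g) (hg0 : ∀ᶠ z in cod, g z ≠ 0)
    (h0 : f =ᶠ[cod] fun z => SE a b P z * g z)
    (h1 : deriv f =ᶠ[cod] fun z => c * deriv g z) : False := by
  obtain ⟨β, hβ⟩ := mero_const (h := fun z => f z - c * g z)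
    (fun z => (hf z).sub ((MeromorphicAt.const c z).mul (hg z))) (by
      filter_upwards [h1, mero_diff hf, mero_diff hg] with z e d1 d2
      have := d1.hasDerivAt.fun_sub (d2.hasDerivAt.const_mul c)
      rwa [e, sub_self] at this)
  have hk : ∀ᶠ z in cod, (SE a b P z - c) * g z = β := by
    filter_upwards [hβ, h0] with z e1 e2
    rw [e2] at e1
    linear_combination e1
  have hrat : IsRatFn (fun z => a.eval z / b.eval z) := (IsRatFn.poly _).div (IsRatFn.poly _)
  have hβ0 : β ≠ 0 := by
    rintro rfl
    have := borel2 (P₁ := P) (P₂ := 0) hrat (IsRatFn.const (-c)) (by simpa using hP) (by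
      filter_upwards [hk, hg0] with z e1 e2
      have := (mul_eq_zero.1 e1).resolve_right e2
      simp only [SE] at this
      simp only [Polynomial.eval_zero, Complex.exp_zero]
      linear_combination this)
    obtain ⟨z, hz⟩ := this.2.exists
    exact hc (neg_eq_zero.1 hz)
  obtain ⟨G, q, hG, hq, he⟩ := hN
  set F : ℂ → ℂ := fun z => a.eval z * exp (P.eval z) - c * b.eval z with hF
  have hFE : EB F := ((EB.poly a).mul (EB_exp P)).sub ((EB.const c).mul (EB.poly b))
  have hev : (fun z => F z * G z) = fun z => β * (q * b).eval z := by
    refine cod_eq (hFE.1.continuous.mul hG.1.continuous) (continuous_const.mul (Polynomial.continuous _)) ?_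
    filter_upwards [hk, he, cod_poly_ne hq, cod_poly_ne hb] with z e1 e2 e3 e4
    rw [e2] at e1
    simp only [SE] at e1
    simp only [hF, Polynomial.eval_mul]
    field_simp at e1
    linear_combination e1
  have hqb : q * b ≠ 0 := mul_ne_zero hq hb
  have hz : ∀ z, F z = 0 → (q * b).eval z = 0 := by
    intro z h
    have := congrFun hev z
    simp only [h, zero_mul] at this
    exact (mul_eq_zero.1 this.symm).resolve_left hβ0
  obtain ⟨z0, hz0⟩ := (cod_poly_ne hqb).exists
  obtain ⟨a', b', u, ha', hb', hu⟩ := hadamard_lite hFE (EB.const 1) ⟨z0, fun h => hz0 (hz z0 h)⟩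
    ⟨0, one_ne_zero⟩ (by
      refine ((q * b).roots.toFinset.finite_toSet).subset ?_
      intro z hzz
      simp only [div_one, Set.mem_setOf_eq] at hzz
      have hFz : F z = 0 := by
        by_contra hne
        apply hzz
        have han : AnalyticAt ℂ F z := hFE.1.analyticAt z
        rw [han.meromorphicOrderAt_eq, han.analyticOrderAt_eq_zero.2 hne]
        rfl
      simpa [hqb] using hz z hFz)
  have hrel : ∀ z, a.eval z * b'.eval z * exp (P.eval z) - a'.eval z * exp (u.eval z) -
      c * b.eval z * b'.eval z = 0 := by
    intro z
    have := hu z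
    simp only [hF] at this
    linear_combination this
  have hab : ¬ ∀ᶠ z in cod, a.eval z * b'.eval z = 0 := by
    intro h
    obtain ⟨z, h1, h2, h3⟩ := (h.and ((cod_poly_ne ha).and (cod_poly_ne hb'))).exists
    exact mul_ne_zero h2 h3 h1
  have hbb : ¬ ∀ᶠ z in cod, -(c * b.eval z * b'.eval z) = 0 := by
    intro h
    obtain ⟨z, h1, h2, h3⟩ := (h.and ((cod_poly_ne hb).and (cod_poly_ne hb'))).exists
    exact neg_ne_zero.2 (mul_ne_zero (mul_ne_zero hc h2) h3) h1
  have r1 : IsRatFn (fun z => a.eval z * b'.eval z) := (IsRatFn.poly _).mul (IsRatFn.poly _)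
  have r2 : IsRatFn (fun z => -(c * b.eval z * b'.eval z)) :=
    (((IsRatFn.const c).mul (IsRatFn.poly _)).mul (IsRatFn.poly _)).neg
  by_cases hu0 : u.derivative = 0
  · obtain ⟨κ, -, hκ⟩ := exp_konst hu0
    have := borel2 (P₁ := P) (P₂ := 0) r1 (r2.sub ((IsRatFn.poly a').mul (IsRatFn.const κ)))
      (by simpa using hP) (by
        filter_upwards with z
        have := hrel z
        rw [hκ z] at this
        simp only [Polynomial.eval_zero, Complex.exp_zero]
        linear_combination this)
    exact hab this.1
  by_cases hu1 : u.derivative = P.derivative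
  · obtain ⟨κ, -, hκ⟩ := exp_ratio hu1
    have := borel2 (P₁ := P) (P₂ := 0) (r1.sub ((IsRatFn.poly a').mul (IsRatFn.const κ))) r2
      (by simpa using hP) (by
        filter_upwards with z
        have := hrel z
        rw [hκ z] at this
        simp only [Polynomial.eval_zero, Complex.exp_zero]
        linear_combination this)
    exact hbb this.2
  · have := borel3 (P₁ := P) (P₂ := u) (P₃ := 0) r1 (IsRatFn.poly a').neg r2
      (fun h => hu1 h.symm) (by simpa using hP) (by simpa using hu0) (by
        filter_upwards with z
        have := hrel z
        simp only [Polynomial.eval_zero, Complex.exp_zero]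
        linear_combination this)
    exact hab this.1

theorem sigma_eq {A B p A₁ B₁ p₁ : Polynomial ℂ} {s₀ s₁ t : ℂ → ℂ} (hA : A ≠ 0) (hB : B ≠ 0)
    (hA1 : A₁ ≠ 0) (hB1 : B₁ ≠ 0) (hp : p.derivative ≠ 0)
    (hs0 : IsRatFn s₀) (hs1 : IsRatFn s₁) (ht : IsRatFn t)
    (n0 : ∀ᶠ z in cod, s₀ z ≠ 0) (n1 : ∀ᶠ z in cod, s₁ z ≠ 0)
    (hσ : ∀ᶠ z in cod, sE A B p z = s₁ z - s₀ z)
    (hrel : ∀ᶠ z in cod, (t z * (SE A B p z - 1) + s₀ z ^ 2 - s₀ z * (s₁ z - s₀ z) * SE A B p z) *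
      (SE A₁ B₁ p₁ z - 1) - s₀ z * s₁ z * (SE A B p z - 1) = 0) :
    ∀ᶠ z in cod, s₁ z - s₀ z = s₀ z := by
  set Q : ℂ → ℂ := fun z => A.eval z / B.eval z with hQ
  set Q₁ : ℂ → ℂ := fun z => A₁.eval z / B₁.eval z with hQ1
  have rQ : IsRatFn Q := (IsRatFn.poly _).div (IsRatFn.poly _)
  have rQ1 : IsRatFn Q₁ := (IsRatFn.poly _).div (IsRatFn.poly _)
  have nQ : ∀ᶠ z in cod, Q z ≠ 0 := by
    filter_upwards [cod_poly_ne hA, cod_poly_ne hB] with z h1 h2 using div_ne_zero h1 h2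
  have nQ1 : ∀ᶠ z in cod, Q₁ z ≠ 0 := by
    filter_upwards [cod_poly_ne hA1, cod_poly_ne hB1] with z h1 h2 using div_ne_zero h1 h2
  have rsq : IsRatFn (fun z => s₀ z * s₀ z) := hs0.mul hs0
  have rX : IsRatFn (fun z => t z - (s₁ z - s₀ z) * s₀ z) := ht.sub ((hs1.sub hs0).mul hs0)
  have rY : IsRatFn (fun z => s₀ z * s₀ z - t z) := rsq.sub ht
  have rZ : IsRatFn (fun z => -(t z) - s₀ z * s₀ z) := ht.neg.sub rsq
  have rW : IsRatFn (fun z => t z - s₀ z * s₀ z + s₀ z * s₁ z) := (ht.sub rsq).add (hs0.mul hs1)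
  have hex : ∀ᶠ z in cod, (t z - (s₁ z - s₀ z) * s₀ z) * (Q z * Q₁ z) *
      (exp (p.eval z) * exp (p₁.eval z)) + (s₀ z * s₀ z - t z) * Q₁ z * exp (p₁.eval z) +
      (-(t z) - s₀ z * s₀ z) * Q z * exp (p.eval z) + (t z - s₀ z * s₀ z + s₀ z * s₁ z) = 0 := by
    filter_upwards [hrel] with z hz
    simp only [SE] at hz
    simp only [hQ, hQ1]
    linear_combination hz
  clear hrel
  -- contradiction when both middle coefficients vanish
  have contra1 : (∀ᶠ z in cod, (s₀ z * s₀ z - t z) * Q₁ z = 0) →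
      (∀ᶠ z in cod, (-(t z) - s₀ z * s₀ z) * Q z = 0) → False := by
    intro e1 e2
    obtain ⟨z, e1, e2, h0, h1, h2⟩ := (e1.and (e2.and (n0.and (nQ.and nQ1)))).exists
    have e3 := (mul_eq_zero.1 e1).resolve_right h2
    have e4 := (mul_eq_zero.1 e2).resolve_right h1
    have : s₀ z * s₀ z = 0 := by linear_combination (e3 - e4) / 2
    exact mul_ne_zero h0 h0 this
  by_cases c0 : p₁.derivative = 0
  · obtain ⟨κ, hκ0, hκ⟩ := exp_konst c0
    have := borel2 (P₁ := p) (P₂ := 0)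
      (((rX.mul (rQ.mul rQ1)).mul (IsRatFn.const κ)).add (rZ.mul rQ))
      (((rY.mul rQ1).mul (IsRatFn.const κ)).add rW) (by simpa using hp) (by
        filter_upwards [hex] with z hz
        rw [hκ z] at hz
        simp only [Polynomial.eval_zero, Complex.exp_zero]
        linear_combination hz)
    filter_upwards [this.1, this.2, n0, n1, nQ] with z e1 e2 h0 h1 h2
    have e3 : (t z - (s₁ z - s₀ z) * s₀ z) * (Q₁ z * κ) + (-(t z) - s₀ z * s₀ z) = 0 := by
      apply mul_left_cancel₀ h2
      linear_combination e1
    have hR : Q₁ z * κ - 1 ≠ 0 := by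
      intro h
      have : s₀ z * s₁ z = 0 := by
        linear_combination e2 - (s₀ z * s₀ z - t z) * h
      exact mul_ne_zero h0 h1 this
    apply mul_left_cancel₀ (mul_ne_zero h0 hR)
    linear_combination -e3 - e2
  by_cases c1 : p₁.derivative = p.derivative
  · exfalso
    obtain ⟨κ, hκ0, hκ⟩ := exp_ratio c1
    have hp2 : (p + p).derivative ≠ p.derivative := by
      rw [Polynomial.derivative_add]
      intro h
      exact hp (by simpa using h)
    have hp3 : (p + p).derivative ≠ (0 : Polynomial ℂ).derivative := by
      rw [Polynomial.derivative_add, ← two_mul, Polynomial.derivative_zero]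
      exact mul_ne_zero two_ne_zero hp
    have := borel3 (P₁ := p + p) (P₂ := p) (P₃ := 0)
      ((rX.mul (rQ.mul rQ1)).mul (IsRatFn.const κ))
      (((rY.mul rQ1).mul (IsRatFn.const κ)).add (rZ.mul rQ)) rW hp2 hp3 (by simpa using hp) (by
        filter_upwards [hex] with z hz
        rw [hκ z] at hz
        simp only [Polynomial.eval_zero, Complex.exp_zero, Polynomial.eval_add, Complex.exp_add]
        linear_combination hz)
    apply hp
    refine (sE_zero (P := p) hA hB ?_).1
    filter_upwards [this.1, this.2.2, n0, nQ, nQ1, hσ] with z e1 e2 h0 h1 h2 h3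
    rw [h3]
    have e3 : t z - (s₁ z - s₀ z) * s₀ z = 0 :=
      (mul_eq_zero.1 ((mul_eq_zero.1 e1).resolve_right hκ0)).resolve_right (mul_ne_zero h1 h2)
    apply mul_left_cancel₀ h0
    linear_combination (e2 - e3) / 2
  by_cases c2 : p₁.derivative = (-p).derivative
  · exfalso
    obtain ⟨κ, hκ0, hκ⟩ := exp_ratio c2
    have hpp : p₁.derivative ≠ p.derivative := c1
    have := borel3 (P₁ := p₁) (P₂ := p) (P₃ := 0)
      (rY.mul rQ1) (rZ.mul rQ) (((rX.mul (rQ.mul rQ1)).mul (IsRatFn.const κ)).add rW)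
      c1 (by simpa using c0) (by simpa using hp) (by
        filter_upwards [hex] with z hz
        have h5 : exp (p.eval z) * exp (p₁.eval z) = κ := by
          rw [hκ z, Polynomial.eval_neg, Complex.exp_neg]
          have := exp_ne_zero (p.eval z)
          field_simp
        rw [h5] at hz
        simp only [Polynomial.eval_zero, Complex.exp_zero]
        linear_combination hz)
    exact contra1 this.1 this.2.1
  · exfalso
    have := borel4 (P₁ := p + p₁) (P₂ := p₁) (P₃ := p) (P₄ := 0)
      (rX.mul (rQ.mul rQ1)) (rY.mul rQ1) (rZ.mul rQ) rW
      (by simpa using hp) (by simpa using c0)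
      (by
        rw [Polynomial.derivative_add, Polynomial.derivative_zero]
        intro h
        apply c2
        rw [Polynomial.derivative_neg]
        exact eq_neg_of_add_eq_zero_right h) c1 (by simpa using c0) (by simpa using hp) (by
        filter_upwards [hex] with z hz
        simp only [Polynomial.eval_zero, Complex.exp_zero, Polynomial.eval_add, Complex.exp_add]
        linear_combination hz)
    exact contra1 this.2.1 this.2.2.1

theorem final_case {f : ℂ → ℂ} {A B p : Polynomial ℂ} {C : ℂ} (hm : ∀ z, MeromorphicAt f z)
    (hA : A ≠ 0) (hB : B ≠ 0) (hp : p.derivative ≠ 0) (hC : C ≠ 0)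
    (hz : {z : ℂ | 0 < meroOrder f z ∧ z.im ≠ 0}.Finite)
    (hEE : ∀ᶠ z in cod, SE A B p z * mtilde (SE A B p) z = 1)
    (hf : f =ᶠ[cod] fun z => C * (1 - SE A B p z)) :
    ∃ (A : ℝ) (B : ℂ) (T : ℂ → ℂ), A ≠ 0 ∧ B ≠ 0 ∧ IsRatFn T ∧
        (∀ x : ℝ, ‖T (x : ℂ)‖ = 1) ∧
        MeroEq f (fun z => B * (1 - T z * Complex.exp (Complex.I * (A : ℂ) * z))) := by
  have hd0 : p.natDegree ≠ 0 := fun h => hp (Polynomial.derivative_eq_zero.2 h)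
  have rat1 : IsRatFn (fun z => A.eval z / B.eval z) := (IsRatFn.poly _).div (IsRatFn.poly _)
  have rat2 : IsRatFn (fun z => (ptilde A).eval z / (ptilde B).eval z) :=
    (IsRatFn.poly _).div (IsRatFn.poly _)
  have hpp : (p + ptilde p).derivative = 0 := by
    by_contra hne
    have := borel2 (P₁ := p + ptilde p) (P₂ := 0) (rat1.mul rat2) (IsRatFn.const (-1))
      (by simpa using hne) (by
        filter_upwards [hEE] with z h
        rw [SE_mtilde] at h
        simp only [SE] at h
        simp only [Polynomial.eval_zero, Complex.exp_zero, Polynomial.eval_add, Complex.exp_add]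
        linear_combination h)
    obtain ⟨z, hz⟩ := this.2.exists
    norm_num at hz
  have hre : p.leadingCoeff.re = 0 := by
    have h1 := Polynomial.derivative_eq_zero.1 hpp
    have h2 : (p + ptilde p).coeff p.natDegree = 0 :=
      Polynomial.coeff_eq_zero_of_natDegree_lt (by omega)
    rw [Polynomial.coeff_add, ptilde, Polynomial.coeff_map] at h2
    have h3 := congrArg Complex.re h2
    simp at h3
    linarith
  have hlc : p.leadingCoeff = I * (p.leadingCoeff.im : ℝ) := by
    apply Complex.ext <;> simp [hre]
  obtain ⟨κ, hκ0, hκ⟩ := exp_konst hpp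
  have hdeg : A.natDegree = B.natDegree := by
    have e : (fun z => (Polynomial.C κ * (A * ptilde A)).eval z) = fun z => (B * ptilde B).eval z := by
      refine cod_eq (Polynomial.continuous _) (Polynomial.continuous _) ?_
      filter_upwards [hEE, cod_poly_ne hB, cod_poly_ne (ptilde_ne hB)] with z h h1 h2
      rw [SE_mtilde] at h
      simp only [SE] at h
      have h3 := hκ z
      rw [Polynomial.eval_add, Complex.exp_add] at h3
      have h4 : A.eval z / B.eval z * ((ptilde A).eval z / (ptilde B).eval z) * κ = 1 := by
        rw [← h3]; linear_combination h
      field_simp at h4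
      simp only [Polynomial.eval_mul, Polynomial.eval_C]
      linear_combination h4
    have e2 := Polynomial.funext (fun z => congrFun e z)
    have e3 := congrArg Polynomial.natDegree e2
    rw [Polynomial.natDegree_C_mul hκ0, Polynomial.natDegree_mul hA (ptilde_ne hA),
      Polynomial.natDegree_mul hB (ptilde_ne hB), ptilde, ptilde, Polynomial.natDegree_map,
      Polynomial.natDegree_map] at e3
    omega
  have hd1 : p.natDegree = 1 := by
    by_contra hne
    have hp2 : 2 ≤ p.natDegree := by omega
    obtain ⟨R, hR⟩ := hz.isBounded.exists_norm_le
    obtain ⟨z, h1, h2, h3, h4⟩ := hit_one A B p hA hB hdeg hp2 _ hlc R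
    refine absurd (hR z ⟨?_, h2⟩) (not_le.2 h1)
    rw [meroOrder, dif_pos (hm z), ← tendsto_zero_iff_meromorphicOrderAt_pos (hm z)]
    have hcont : ContinuousAt (fun z => C * (1 - SE A B p z)) z := by
      have : ContinuousAt (SE A B p) z :=
        ((Polynomial.continuous _).continuousAt.div (Polynomial.continuous _).continuousAt h3).mul
          (Complex.continuous_exp.comp (Polynomial.continuous _)).continuousAt
      exact (this.const_sub 1).const_mul C
    have h5 : C * (1 - SE A B p z) = 0 := by
      rw [show SE A B p z = 1 from h4]; ring
    have h6 := hcont.tendsto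
    rw [h5] at h6
    refine (h6.mono_left nhdsWithin_le_nhds).congr' ?_
    exact (ev_cod_iff.1 hf z).mono fun w hw => hw.symm
  set α := p.leadingCoeff.im with hα
  have hα0 : α ≠ 0 := by
    intro h
    rw [h] at hlc
    have : p = 0 := by simpa using hlc
    simp [this] at hp
  have hpe : ∀ z, p.eval z = I * α * z + p.coeff 0 := by
    intro z
    have h1 : p.coeff 1 = I * α := by rw [← hlc, Polynomial.leadingCoeff, hd1]
    rw [Polynomial.eval_eq_sum_range, hd1, Finset.sum_range_succ, Finset.sum_range_one, h1]
    ring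
  set T₀ : ℂ → ℂ := fun z => A.eval z / B.eval z * exp (p.coeff 0) with hT0
  have hSE : ∀ z, SE A B p z = T₀ z * exp (I * α * z) := by
    intro z
    simp only [SE, hT0, hpe, Complex.exp_add]
    ring
  have hexpn : ∀ x : ℂ, x.im = 0 → ‖exp (I * α * x)‖ = 1 := by
    intro x hx
    rw [Complex.norm_exp]
    simp [hx]
  set T : ℂ → ℂ := fun z => if ‖T₀ z‖ = 1 ∨ z.im ≠ 0 then T₀ z else 1 with hT
  have hTT : T =ᶠ[cod] T₀ := by
    filter_upwards [hEE] with z h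
    simp only [hT]
    rw [if_pos]
    by_cases hz0 : z.im = 0
    · left
      have hc : (starRingEnd ℂ) z = z := Complex.conj_eq_iff_im.2 hz0
      rw [mtilde, hc, Complex.mul_conj, hSE, Complex.normSq_eq_norm_sq, norm_mul, hexpn z hz0, mul_one] at h
      have h2 : ‖T₀ z‖ ^ 2 = 1 := by exact_mod_cast h
      exact (pow_eq_one_iff_of_nonneg (norm_nonneg _) two_ne_zero).1 h2
    · right; exact hz0
  refine ⟨α, C, T, hα0, hC, (rat1.mul (IsRatFn.const _)).congr hTT, ?_, ?_⟩
  · intro x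
    simp only [hT]
    split_ifs with h
    · rcases h with h | h
      · exact h
      · simp at h
    · simp
  · rw [meroEq_iff]
    filter_upwards [hf, hTT] with z h1 h2
    rw [h1, h2, hSE]

theorem Nice.tilde {f : ℂ → ℂ} (h : Nice f) : Nice (mtilde f) := by
  obtain ⟨F, q, hF, hq, he⟩ := h
  refine ⟨mtilde F, ptilde q, hF.tilde, ptilde_ne hq, (cod_mtilde he).trans ?_⟩
  filter_upwards with z
  simp only [mtilde, ptilde_eval, map_div₀]

theorem cod_tilde_ne {f : ℂ → ℂ} (h : ∀ᶠ z in cod, f z ≠ 0) : ∀ᶠ z in cod, mtilde f z ≠ 0 := by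
  filter_upwards [tendsto_conj_cod.eventually h] with z hz
  simpa [mtilde] using hz

theorem SE_tilde_one {φ : ℂ → ℂ} {a b P : Polynomial ℂ} (hn : ∀ᶠ z in cod, φ z ≠ 0)
    (h : φ =ᶠ[cod] fun z => SE a b P z * mtilde φ z) :
    ∀ᶠ z in cod, SE a b P z * mtilde (SE a b P) z = 1 := by
  have h2 : mtilde φ =ᶠ[cod] fun z => mtilde (SE a b P) z * φ z := by
    refine (cod_mtilde h).trans ?_
    filter_upwards with z
    simp [mtilde]
  filter_upwards [h, h2, hn] with z e1 e2 e3
  rw [e2] at e1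
  apply mul_right_cancel₀ e3
  linear_combination -e1

theorem core {f : ℂ → ℂ} (hm : ∀ z, MeromorphicAt f z) (hsn : StrictlyNonReal f) (hN : Nice f)
    (hz0 : {z : ℂ | 0 < meroOrder f z ∧ z.im ≠ 0}.Finite)
    (hz1 : {z : ℂ | 0 < meroOrder (deriv f) z ∧ z.im ≠ 0}.Finite)
    (hz2 : {z : ℂ | 0 < meroOrder (deriv (deriv f)) z ∧ z.im ≠ 0}.Finite) :
    IsRatFn (fun z => deriv f z / f z) ∨
      ∃ (A : ℝ) (B : ℂ) (T : ℂ → ℂ), A ≠ 0 ∧ B ≠ 0 ∧ IsRatFn T ∧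
        (∀ x : ℝ, ‖T (x : ℂ)‖ = 1) ∧
        MeroEq f (fun z => B * (1 - T z * Complex.exp (Complex.I * (A : ℂ) * z))) := by
  have hm1 : ∀ z, MeromorphicAt (deriv f) z := fun z => (hm z).deriv
  have hm2 : ∀ z, MeromorphicAt (deriv (deriv f)) z := fun z => (hm1 z).deriv
  have nf0 := cod_ne_of_finite hm hN hz0
  have nf1 := cod_ne_of_finite hm1 hN.deriv hz1
  have nf2 := cod_ne_of_finite hm2 hN.deriv.deriv hz2
  obtain ⟨a₀, b₀, P₀, ha0, hb0, e0⟩ := exists_S hm hN hz0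
  obtain ⟨a₁, b₁, P₁, ha1, hb1, e1⟩ := exists_S hm1 hN.deriv hz1
  obtain ⟨a₂, b₂, P₂, ha2, hb2, e2⟩ := exists_S hm2 hN.deriv.deriv hz2
  replace e0 : f =ᶠ[cod] fun z => SE a₀ b₀ P₀ z * mtilde f z := e0
  replace e1 : deriv f =ᶠ[cod] fun z => SE a₁ b₁ P₁ z * mtilde (deriv f) z := e1
  replace e2 : deriv (deriv f) =ᶠ[cod] fun z => SE a₂ b₂ P₂ z * mtilde (deriv (deriv f)) z := e2
  have u0 := SE_tilde_one nf0 e0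
  have u1 := SE_tilde_one nf1 e1
  have ng0 := cod_tilde_ne nf0
  have ng1 := cod_tilde_ne nf1
  set g := mtilde f with hg
  have hg1 : mtilde (deriv f) = deriv g := (deriv_mtilde f).symm
  have hg2 : mtilde (deriv (deriv f)) = deriv (deriv g) := by
    rw [← deriv_mtilde, hg1]
  rw [hg1] at e1 ng1
  rw [hg2] at e2
  have hmg : ∀ z, MeromorphicAt g z := fun z => mtilde_meromorphicAt (hm _)
  have hmg1 : ∀ z, MeromorphicAt (deriv g) z := fun z => (hmg z).deriv
  have hNg : Nice g := hN.tilde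
  set A := a₁ * b₀ with hA
  set B := b₁ * a₀ with hB
  set p := P₁ - P₀ with hpdef
  set A₁ := a₂ * b₁ with hA1
  set B₁ := b₂ * a₁ with hB1
  set p₁ := P₂ - P₁ with hp1def
  have hA0 : A ≠ 0 := mul_ne_zero ha1 hb0
  have hB0 : B ≠ 0 := mul_ne_zero hb1 ha0
  have hA10 : A₁ ≠ 0 := mul_ne_zero ha2 hb1
  have hB10 : B₁ ≠ 0 := mul_ne_zero hb2 ha1
  have rE : ∀ᶠ z in cod, SE a₁ b₁ P₁ z = SE A B p z * SE a₀ b₀ P₀ z := SE_ratio P₀ P₁ ha0 hb0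
  have rE1 : ∀ᶠ z in cod, SE a₂ b₂ P₂ z = SE A₁ B₁ p₁ z * SE a₁ b₁ P₁ z := SE_ratio P₁ P₂ ha1 hb1
  have hσ : ∀ᶠ z in cod, sE A B p z = sE a₁ b₁ P₁ z - sE a₀ b₀ P₀ z :=
    sE_ratio P₀ P₁ ha0 hb0 ha1 hb1
  set s₀ := sE a₀ b₀ P₀ with hs0
  set s₁ := sE a₁ b₁ P₁ with hs1
  have rs0 : IsRatFn s₀ := sE_rat _ _ _
  have rs1 : IsRatFn s₁ := sE_rat _ _ _
  have rel0 : ∀ᶠ z in cod, s₀ z * g z = (SE A B p z - 1) * deriv g z :=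
    rel_step ha0 hb0 e0 (by
      filter_upwards [e1, rE] with z h1 h2
      rw [h1, h2]) hmg
  have rel1 : ∀ᶠ z in cod, s₁ z * deriv g z = (SE A₁ B₁ p₁ z - 1) * deriv (deriv g) z :=
    rel_step ha1 hb1 e1 (by
      filter_upwards [e2, rE1] with z h1 h2
      rw [h1, h2]) hmg1
  -- s₀ is not identically zero
  have n0 : ∀ᶠ z in cod, s₀ z ≠ 0 := by
    rcases rs0.dich with h | h
    · exfalso
      obtain ⟨c, hc⟩ := (sE_zero ha0 hb0 h).2
      have hc0 : c ≠ 0 := by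
        obtain ⟨z, h1, h2⟩ := (hc.and (SE_ne P₀ ha0 hb0)).exists
        rwa [h1] at h2
      apply hsn
      refine ⟨c⁻¹, ?_⟩
      rw [meroEq_iff]
      filter_upwards [e0, hc] with z h1 h2
      rw [h1, h2]
      field_simp
      rfl
    · exact h
  have nE : ∀ᶠ z in cod, SE A B p z - 1 ≠ 0 := by
    filter_upwards [rel0, n0, ng0] with z h1 h2 h3 h4
    rw [h4, zero_mul] at h1
    exact mul_ne_zero h2 h3 h1
  by_cases hp : p.derivative = 0
  · left
    obtain ⟨κ, -, hκ⟩ := exp_konst hp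
    have rEr : IsRatFn (SE A B p) := by
      refine (((IsRatFn.poly A).div (IsRatFn.poly B)).mul (IsRatFn.const κ)).congr ?_
      filter_upwards with z
      simp only [SE, hκ]
    refine ((rEr.mul rs0).div (rEr.sub (IsRatFn.const 1))).congr ?_
    filter_upwards [e0, e1, rE, rel0, nE, ng0, SE_ne P₀ ha0 hb0] with z h0 h1 h2 h3 h4 h5 h6
    rw [h0, h1, h2]
    field_simp
    linear_combination -(SE A B p z) * h3
  right
  -- s₁ is not identically zero
  have n1 : ∀ᶠ z in cod, s₁ z ≠ 0 := by
    rcases rs1.dich with h | h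
    · exfalso
      obtain ⟨hP1, c, hc⟩ := sE_zero ha1 hb1 h
      have hc0 : c ≠ 0 := by
        obtain ⟨z, h1, h2⟩ := (hc.and (SE_ne P₁ ha1 hb1)).exists
        rwa [h1] at h2
      have hP0 : P₀.derivative ≠ 0 := by
        intro h0
        apply hp
        rw [hpdef, Polynomial.derivative_sub, hP1, h0, sub_zero]
      refine case_s1 ha0 hb0 hP0 hc0 hm hmg hNg ng0 e0 ?_
      filter_upwards [e1, hc] with z h1 h2
      rw [h1, h2]
    · exact h
  have rt : IsRatFn (deriv s₀) := rs0.deriv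
  have hrel : ∀ᶠ z in cod, (deriv s₀ z * (SE A B p z - 1) + s₀ z ^ 2 -
      s₀ z * (s₁ z - s₀ z) * SE A B p z) * (SE A₁ B₁ p₁ z - 1) -
      s₀ z * s₁ z * (SE A B p z - 1) = 0 := by
    filter_upwards [cod_deriv rel0, rel0, rel1, rs0.diff, mero_diff hmg, mero_diff hmg1,
      SE_deriv p hA0 hB0, hσ, ng1] with z d r0 r1 ds dg dg1 dE hs hn
    have d1 := (ds.hasDerivAt.fun_mul dg.hasDerivAt).deriv
    have d2 := ((dE.sub_const 1).fun_mul dg1.hasDerivAt).deriv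
    rw [d1, d2, hs] at d
    apply mul_right_cancel₀ hn
    linear_combination (s₀ z * (SE A₁ B₁ p₁ z - 1)) * d
      - (SE A₁ B₁ p₁ z - 1) * deriv s₀ z * r0 - s₀ z * (SE A B p z - 1) * r1
  have hseq := sigma_eq hA0 hB0 hA10 hB10 hp rs0 rs1 rt n0 n1 hσ hrel
  -- integrate
  have hEmero := SE_mero A B p
  obtain ⟨C, hC⟩ := mero_const (h := fun z => g z * SE A B p z / (SE A B p z - 1))
    (fun z => ((hmg z).mul (hEmero z)).div ((hEmero z).sub (MeromorphicAt.const 1 z))) (by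
      filter_upwards [mero_diff hmg, SE_deriv p hA0 hB0, nE, rel0, hσ, hseq] with z dg dE hn r hs hq
      refine ((dg.hasDerivAt.fun_mul dE).fun_div (dE.sub_const 1) hn).congr_deriv ?_
      rw [hs, hq]
      field_simp
      linear_combination (-(SE A B p z)) * r)
  have hEne := SE_ne p hA0 hB0
  have hC0 : C ≠ 0 := by
    obtain ⟨z, h1, h2, h3, h4⟩ := (hC.and (hEne.and (nE.and ng0))).exists
    rw [← h1]
    exact div_ne_zero (mul_ne_zero h4 h2) h3
  have hgE : (fun z => g z * SE A B p z) =ᶠ[cod] fun z => C * (SE A B p z - 1) := by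
    filter_upwards [hC, nE] with z h1 h2
    rwa [div_eq_iff h2] at h1
  have hEE : ∀ᶠ z in cod, SE A B p z * mtilde (SE A B p) z = 1 := by
    have rEt : mtilde (SE a₁ b₁ P₁) =ᶠ[cod] mtilde (fun z => SE A B p z * SE a₀ b₀ P₀ z) := cod_mtilde rE
    filter_upwards [rE, rEt, u0, u1] with z h1 h2 h3 h4
    rw [h1, h2] at h4
    simp only [mtilde, map_mul] at h3 h4 ⊢
    linear_combination h4 - SE A B p z * (starRingEnd ℂ) (SE A B p ((starRingEnd ℂ) z)) * h3
  refine final_case (A := A) (B := B) (p := p) (C := (starRingEnd ℂ) C) hm hA0 hB0 hp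
    (by simpa using hC0) hz0 hEE ?_
  filter_upwards [cod_mtilde hgE, hEE] with z h1 h2
  simp only [mtilde, hg, map_mul, map_sub, map_one, Complex.conj_conj] at h1 h2
  linear_combination SE A B p z * h1 + ((starRingEnd ℂ) C - f z) * h2

/-- Lemma 3.4 of the paper: under the Setup, if `f` has finite order and
finitely many poles, then either `f'/f` is rational or `f(z) = B(1 - T(z) exp(i A z))`. -/
theorem statement_12 (M : ℕ) (f : ℂ → ℂ) (hs : Setup M f)
    (hord : FiniteOrder f) (hpoles : {z : ℂ | meroOrder f z < 0}.Finite) :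
    IsRatFn (fun z => deriv f z / f z) ∨
      ∃ (A : ℝ) (B : ℂ) (T : ℂ → ℂ), A ≠ 0 ∧ B ≠ 0 ∧ IsRatFn T ∧
        (∀ x : ℝ, ‖T (x : ℂ)‖ = 1) ∧
        MeroEq f (fun z => B * (1 - T z * Complex.exp (Complex.I * (A : ℂ) * z))) := by
  obtain ⟨-, hm, hsn, hz⟩ := hs
  have h0 := hz 0 (by omega)
  have h1 := hz 1 (by omega)
  have h2 := hz 2 (by omega)
  rw [iteratedDeriv_zero] at h0
  rw [iteratedDeriv_one] at h1
  rw [iteratedDeriv_succ, iteratedDeriv_one] at h2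
  exact core hm hsn (nice_of_finiteOrder hm hord hpoles) h0 h1 h2
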